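/- The index set BCL = {e : e codes a u.c.e. family that is TxtBC-learnable by some learner} is Σ⁰₅-hard: every Σ⁰₅ set many-one reduces to BCL via a computable function. -/

import Mathlib

/-- `Wset e` is the `e`-th computably enumerable set: the domain of the `e`-th
partial computable function in the standard numbering by codes. -/
def Wset (e : ℕ) : Set ℕ :=
  {x | ((Denumerable.ofNat Nat.Partrec.Code e).eval x).Dom}

/-- The `i`-th column `{x : ⟨i,x⟩ ∈ W_a}` of the c.e. set coded by `a`;
the number `a` codes the u.c.e. family whose members are its columns. -/
def column (a i : ℕ) : Set ℕ := {x | Nat.pair i x ∈ Wset a}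

/-- The initial segment of length `n` of an enumeration `f`. -/
def initSeg (f : ℕ → ℕ) (n : ℕ) : List ℕ := (List.range n).map f

/-- The `m`-th computable learner in the standard effective enumeration of all
partial computable functions from finite sequences to ℕ. -/
def learnerOfCode (m : ℕ) : List ℕ →. ℕ :=
  fun σ => (Denumerable.ofNat Nat.Partrec.Code m).eval (Encodable.encode σ)

/-- `M` TxtFin-identifies the enumeration `f` (here `Option.none` plays the
role of the symbol `?`). -/
def TxtFinIdentifies (M : List ℕ →. Option ℕ) (f : ℕ → ℕ) : Prop :=
  ∃ n h, (∀ n' < n, M (initSeg f n') = Part.some Option.none) ∧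
    M (initSeg f n) = Part.some (Option.some h) ∧ Wset h = Set.range f

/-- `M` TxtFin-learns the set `S`. -/
def TxtFinLearnsSet (M : List ℕ →. Option ℕ) (S : Set ℕ) : Prop :=
  ∀ f : ℕ → ℕ, Set.range f = S → TxtFinIdentifies M f

/-- `M` TxtEx-identifies the enumeration `f`. -/
def TxtExIdentifies (M : List ℕ →. ℕ) (f : ℕ → ℕ) : Prop :=
  ∃ n, (∃ N, ∀ i ≥ N, M (initSeg f i) = Part.some n) ∧ Wset n = Set.range f

/-- `M` TxtEx-learns the set `S`. -/
def TxtExLearnsSet (M : List ℕ →. ℕ) (S : Set ℕ) : Prop :=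
  ∀ f : ℕ → ℕ, Set.range f = S → TxtExIdentifies M f

/-- `M` TxtBC-identifies the enumeration `f`. -/
def TxtBCIdentifies (M : List ℕ →. ℕ) (f : ℕ → ℕ) : Prop :=
  ∃ N, ∀ i ≥ N, ∃ h, M (initSeg f i) = Part.some h ∧ Wset h = Set.range f

/-- `M` TxtBC-learns the set `S`. -/
def TxtBCLearnsSet (M : List ℕ →. ℕ) (S : Set ℕ) : Prop :=
  ∀ f : ℕ → ℕ, Set.range f = S → TxtBCIdentifies M f

/-- `M` TxtEx*-identifies the enumeration `f`. -/
def TxtExStarIdentifies (M : List ℕ →. ℕ) (f : ℕ → ℕ) : Prop :=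
  ∃ n, (∃ N, ∀ i ≥ N, M (initSeg f i) = Part.some n) ∧
    (symmDiff (Wset n) (Set.range f)).Finite

/-- `M` TxtEx*-learns the set `S`. -/
def TxtExStarLearnsSet (M : List ℕ →. ℕ) (S : Set ℕ) : Prop :=
  ∀ f : ℕ → ℕ, Set.range f = S → TxtExStarIdentifies M f

/-- Indices of cofinite c.e. sets. -/
def COF : Set ℕ := {e | (Wset e)ᶜ.Finite}

/-- Indices of coinfinite c.e. sets. -/
def COINF : Set ℕ := {e | (Wset e)ᶜ.Infinite}

/-- `P` is Σ⁰₃: definable by `∃∀∃` over a computable relation. -/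
def IsSigma3 (P : Set ℕ) : Prop :=
  ∃ R : ℕ → ℕ → ℕ → ℕ → Bool,
    Computable (fun p : ℕ × ℕ × ℕ × ℕ => R p.1 p.2.1 p.2.2.1 p.2.2.2) ∧
    ∀ e, e ∈ P ↔ ∃ x, ∀ y, ∃ z, R e x y z = true

/-- `P` is Σ⁰₄: definable by `∃∀∃∀` over a computable relation. -/
def IsSigma4 (P : Set ℕ) : Prop :=
  ∃ R : ℕ → ℕ → ℕ → ℕ → ℕ → Bool,
    Computable (fun p : ℕ × ℕ × ℕ × ℕ × ℕ =>
      R p.1 p.2.1 p.2.2.1 p.2.2.2.1 p.2.2.2.2) ∧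
    ∀ e, e ∈ P ↔ ∃ x, ∀ y, ∃ z, ∀ w, R e x y z w = true

/-- `P` is Σ⁰₅: definable by `∃∀∃∀∃` over a computable relation. -/
def IsSigma5 (P : Set ℕ) : Prop :=
  ∃ R : ℕ → ℕ → ℕ → ℕ → ℕ → ℕ → Bool,
    Computable (fun p : ℕ × ℕ × ℕ × ℕ × ℕ × ℕ =>
      R p.1 p.2.1 p.2.2.1 p.2.2.2.1 p.2.2.2.2.1 p.2.2.2.2.2) ∧
    ∀ e, e ∈ P ↔ ∃ x, ∀ y, ∃ z, ∀ w, ∃ v, R e x y z w v = true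

/-- `f : ℕ → ℕ` is Δ⁰₂: the pointwise limit of a computable function. -/
def IsDelta2Fun (f : ℕ → ℕ) : Prop :=
  ∃ g : ℕ → ℕ → ℕ, Computable₂ g ∧ ∀ x, ∃ s₀, ∀ s ≥ s₀, g s x = f x

/-- The index set of codes of TxtBC-learnable u.c.e. families. -/
def BCL : Set ℕ :=
  {e | ∃ M : List ℕ →. ℕ, Partrec M ∧ ∀ i, TxtBCLearnsSet M (column e i)}

open Filter

/-- The sequence that visits `z` whenever a pair `⟨z, s⟩` with `act z s` comes up,
and grows otherwise. -/
def sample (act : ℕ → ℕ → Bool) (t : ℕ) : ℕ :=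
  bif act (Nat.unpair t).1 (Nat.unpair t).2 then (Nat.unpair t).1 else t

theorem tendsto_sample_iff (act : ℕ → ℕ → Bool) :
    Tendsto (sample act) atTop atTop ↔ ∀ z, {s | act z s = true}.Finite := by
  constructor
  · intro h z
    obtain ⟨T, hT⟩ := eventually_atTop.1 (h.eventually_gt_atTop z)
    refine (Set.finite_Iio T).subset fun s hs => ?_
    by_contra hc
    have h1 := hT (Nat.pair z s) (le_trans (by simpa using hc) (Nat.right_le_pair z s))
    have hs' : act z s = true := hs
    simp [sample, hs'] at h1
  · intro h
    rw [tendsto_atTop]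
    intro B
    have hfin : (Set.Iio B ∪ ⋃ z ∈ Set.Iio B, Nat.pair z '' {s | act z s = true}).Finite :=
      (Set.finite_Iio B).union ((Set.finite_Iio B).biUnion fun z _ => (h z).image _)
    rw [← Nat.cofinite_eq_atTop]
    refine hfin.subset fun t ht => ?_
    have ht' : sample act t < B := not_le.1 ht
    unfold sample at ht'
    cases ha : act (Nat.unpair t).1 (Nat.unpair t).2
    · rw [ha] at ht'; exact Or.inl ht'
    · rw [ha] at ht'
      refine Or.inr (Set.mem_biUnion (x := (Nat.unpair t).1) ht' ⟨(Nat.unpair t).2, ha, by simp⟩)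

/-- The number of successive `w` for which a witness has been found by stage `t`. -/
def progress (r : ℕ → ℕ → Bool) : ℕ → ℕ
  | 0 => 0
  | t + 1 => bif r (progress r t) (Nat.unpair t).1 then progress r t + 1 else progress r t

theorem progress_succ (r : ℕ → ℕ → Bool) (t : ℕ) : progress r (t + 1) =
    bif r (progress r t) (Nat.unpair t).1 then progress r t + 1 else progress r t := rfl

theorem progress_mono (r : ℕ → ℕ → Bool) : Monotone (progress r) := by
  refine monotone_nat_of_le_succ fun t => ?_
  rw [progress_succ]
  cases r (progress r t) (Nat.unpair t).1 <;> simp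

theorem infinite_progress_iff (r : ℕ → ℕ → Bool) :
    {t | r (progress r t) (Nat.unpair t).1 = true}.Infinite ↔ ∀ w, ∃ v, r w v = true := by
  constructor
  · intro h w
    by_contra hw
    push Not at hw
    have hle : ∀ t, progress r t ≤ w := by
      intro t
      induction t with
      | zero => exact Nat.zero_le _
      | succ t ih =>
        rw [progress_succ]
        rcases ih.lt_or_eq with hlt | heq
        · cases r (progress r t) (Nat.unpair t).1 <;> simp <;> omega
        · have := hw (Nat.unpair t).1
          rw [heq]
          simp [this]
    have hge : ∀ k, ∃ t, k ≤ progress r t := by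
      intro k
      induction k with
      | zero => exact ⟨0, Nat.zero_le _⟩
      | succ k ih =>
        obtain ⟨t, ht⟩ := ih
        obtain ⟨s, hs, hts⟩ := h.exists_gt t
        refine ⟨s + 1, ?_⟩
        have hs' : r (progress r s) (Nat.unpair s).1 = true := hs
        rw [progress_succ, hs']
        have := progress_mono r hts.le
        simp; omega
    obtain ⟨t, ht⟩ := hge (w + 1)
    have := hle t
    omega
  · intro h hfin
    obtain ⟨T, hT⟩ := hfin.bddAbove
    have hT' : ∀ t > T, r (progress r t) (Nat.unpair t).1 = false := by
      intro t ht
      by_contra hc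
      exact absurd (hT (Bool.not_eq_false _ ▸ hc : r (progress r t) (Nat.unpair t).1 = true))
        (not_le.2 ht)
    have hconst : ∀ t ≥ T + 1, progress r t = progress r (T + 1) := by
      intro t ht
      induction t, ht using Nat.le_induction with
      | base => rfl
      | succ s hs ih => rw [progress_succ, hT' s hs, cond_false, ih]
    obtain ⟨v, hv⟩ := h (progress r (T + 1))
    have h1 := Nat.right_le_pair v (T + 1)
    have h2 := hT' (Nat.pair v (T + 1)) h1
    rw [hconst _ h1] at h2
    simp [hv] at h2

namespace Guide

/-- An outcome: `none` for convergence to infinity, `some (z, c)` for lower limit `z` with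
modulus `c`. -/
abbrev Outcome := Option (ℕ × ℕ)

/-- The outcome `o` is correct for the sequence `κ`. -/
def Correct (κ : ℕ → ℕ) : Outcome → Prop
  | none => Tendsto κ atTop atTop
  | some (z, c) => (∀ T, ∃ t ≥ T, κ t ≤ z) ∧ (∀ t ≥ c, z ≤ κ t) ∧ (c = 0 ∨ κ (c - 1) < z)

theorem exists_correct (κ : ℕ → ℕ) : ∃ o, Correct κ o := by
  by_cases h : Tendsto κ atTop atTop
  · exact ⟨none, h⟩
  have hex : ∃ z, ∀ T, ∃ t ≥ T, κ t ≤ z := by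
    rw [tendsto_atTop_atTop] at h
    push Not at h
    obtain ⟨z, hz⟩ := h
    exact ⟨z, fun T => (hz T).imp fun t ht => ⟨ht.1, ht.2.le⟩⟩
  classical
  have hz := Nat.find_spec hex
  have hc : ∃ c, ∀ t ≥ c, Nat.find hex ≤ κ t := by
    rcases Nat.eq_zero_or_pos (Nat.find hex) with h0 | h0
    · exact ⟨0, fun t _ => by omega⟩
    · have := Nat.find_min hex (Nat.sub_lt h0 one_pos)
      push Not at this
      obtain ⟨T, hT⟩ := this
      exact ⟨T, fun t ht => by have := hT t ht; omega⟩
  refine ⟨some (Nat.find hex, Nat.find hc), hz, Nat.find_spec hc, ?_⟩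
  rcases Nat.eq_zero_or_pos (Nat.find hc) with h0 | h0
  · exact Or.inl h0
  · right
    have := Nat.find_min hc (Nat.sub_lt h0 one_pos)
    push Not at this
    obtain ⟨t, ht, hlt⟩ := this
    have : t = Nat.find hc - 1 := by
      by_contra hne
      have := Nat.find_spec hc t (by omega)
      omega
    rwa [this] at hlt

theorem Correct.not_some {κ : ℕ → ℕ} (h : Correct κ none) (z c : ℕ) :
    ¬ Correct κ (some (z, c)) := by
  rintro ⟨h1, -, -⟩
  obtain ⟨T, hT⟩ := eventually_atTop.1 (Tendsto.eventually_gt_atTop h z)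
  obtain ⟨t, ht, hle⟩ := h1 T
  have := hT t ht
  omega

theorem Correct.unique {κ : ℕ → ℕ} {o o' : Outcome} (h : Correct κ o) (h' : Correct κ o') :
    o = o' := by
  rcases o with _ | ⟨z, c⟩ <;> rcases o' with _ | ⟨z', c'⟩
  · rfl
  · exact absurd h' (h.not_some z' c')
  · exact absurd h (h'.not_some z c)
  · obtain ⟨h1, h2, h3⟩ := h
    obtain ⟨h1', h2', h3'⟩ := h'
    have hz : z = z' := by
      obtain ⟨t, ht, hle⟩ := h1 c'
      obtain ⟨t', ht', hle'⟩ := h1' c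
      have := h2' t ht
      have := h2 t' ht'
      omega
    subst hz
    have hc : c = c' := by
      rcases lt_trichotomy c c' with h | h | h
      · have := h2 (c' - 1) (by omega)
        omega
      · exact h
      · have := h2' (c - 1) (by omega)
        omega
    rw [hc]

/-- Stage-wise refutation of the correctness of an outcome. -/
def refute (κ : ℕ → ℕ) (o : Outcome) (b t : ℕ) : Prop :=
  (o = none ∧ κ t ≤ b) ∨
  (∃ u ∈ o, (∀ t' < t, t' < b ∨ u.1 < κ t') ∨ (u.2 ≤ b ∧ κ b < u.1) ∨
    (u.2 ≠ 0 ∧ u.1 ≤ κ (u.2 - 1)))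

theorem correct_iff (κ : ℕ → ℕ) (o : Outcome) :
    Correct κ o ↔ ∀ b, {t | refute κ o b t}.Finite := by
  rcases o with _ | ⟨z, c⟩
  · simp only [Correct, refute, true_and]
    rw [← Nat.cofinite_eq_atTop, Nat.cofinite_eq_atTop, tendsto_atTop]
    refine ⟨fun h b => ?_, fun h b => ?_⟩
    · have := h (b + 1)
      rw [← Nat.cofinite_eq_atTop] at this
      refine Set.Finite.subset this fun t ht => ?_
      have : κ t ≤ b := by simpa using ht
      change ¬ (b + 1 ≤ κ t)
      omega
    · rw [← Nat.cofinite_eq_atTop]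
      refine Set.Finite.subset (h b) fun t ht => ?_
      have : ¬ (b ≤ κ t) := ht
      exact Or.inl (by omega)
  · constructor
    · rintro ⟨h1, h2, h3⟩ b
      obtain ⟨t, ht, hle⟩ := h1 b
      refine (Set.finite_Iic t).subset fun s hs => ?_
      rcases hs with ⟨h, -⟩ | ⟨u, hu, h⟩
      · cases h
      · cases hu
        rcases h with h | h | h
        · by_contra hc
          have := h t (by simpa using hc)
          simp at this
          omega
        · have := h2 b h.1
          simp at h
          omega
        · simp at h
          omega
    · intro h
      refine ⟨fun T => ?_, fun t ht => ?_, ?_⟩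
      · by_contra hc
        push Not at hc
        refine Set.infinite_univ (α := ℕ) ((h T).subset fun s _ => Or.inr ⟨_, rfl, Or.inl ?_⟩)
        intro t' _
        by_cases hT : t' < T
        · exact Or.inl hT
        · exact Or.inr (hc t' (by omega))
      · by_contra hc
        exact Set.infinite_univ (α := ℕ)
          ((h t).subset fun s _ => Or.inr ⟨_, rfl, Or.inr (Or.inl ⟨ht, by simpa using hc⟩)⟩)
      · by_contra hc
        push Not at hc
        exact Set.infinite_univ (α := ℕ)
          ((h 0).subset fun s _ => Or.inr ⟨_, rfl, Or.inr (Or.inr hc)⟩)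

section

variable (χ : ℕ → ℕ → ℕ → ℕ)

/-- The sequence examined after the outcomes `l` (most recent first). -/
def seqAt (l : List Outcome) : ℕ → ℕ := χ (l.count none) (Nat.unpair l.length).1

/-- All the outcomes in `l` are correct. -/
def Run : List Outcome → Prop
  | [] => True
  | o :: l => Run l ∧ Correct (seqAt χ l) o

variable {χ}

theorem Run.unique {l l' : List Outcome} (h : Run χ l) (h' : Run χ l')
    (hl : l.length = l'.length) : l = l' := by
  induction l generalizing l' with
  | nil => exact (List.length_eq_zero_iff.1 hl.symm).symm
  | cons o l ih =>
    cases l' with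
    | nil => simp at hl
    | cons o' l' =>
      obtain rfl := ih h.1 h'.1 (by simpa using hl)
      rw [h.2.unique h'.2]

theorem Run.drop {l : List Outcome} (h : Run χ l) (n : ℕ) : Run χ (l.drop n) := by
  induction n generalizing l with
  | zero => simpa
  | succ n ih =>
    cases l with
    | nil => simpa
    | cons o l => exact ih h.1

theorem run_iff (l : List Outcome) :
    Run χ l ↔ ∀ i o, l[i]? = some o → Correct (seqAt χ (l.drop (i + 1))) o := by
  induction l with
  | nil => simp [Run]
  | cons a l ih =>
    rw [Run, ih]
    constructor
    · rintro ⟨h1, h2⟩ i o hi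
      cases i with
      | zero => simp at hi; subst hi; simpa using h2
      | succ i => exact h1 i o (by simpa using hi)
    · intro h
      exact ⟨fun i o hi => h (i + 1) o (by simpa using hi), by simpa using h 0 a (by simp)⟩

theorem Run.count_lt {l : List Outcome} {x : ℕ}
    (hx : ∀ y, ¬ Tendsto (χ x y) atTop atTop) (h : Run χ l) : l.count none ≤ x := by
  induction l with
  | nil => simp
  | cons o l ih =>
    have h1 := ih h.1
    rcases o with _ | o
    · have h2 : Tendsto (χ (l.count none) (Nat.unpair l.length).1) atTop atTop := h.2
      have : l.count none ≠ x := fun hc => hx _ (hc ▸ h2)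
      rw [List.count_cons_self]
      omega
    · simpa using h1

theorem Run.eq_of_count_eq {l l' : List Outcome} (h : Run χ (none :: l)) (h' : Run χ (none :: l'))
    (hc : l.count none = l'.count none) : l = l' := by
  have key : ∀ l l' : List Outcome, Run χ (none :: l) → Run χ (none :: l') →
      l.count none = l'.count none → ¬ l.length < l'.length := by
    intro l l' h h' hc hlt
    have h1 : l'.drop (l'.length - (l.length + 1)) = none :: l :=
      (h'.1.drop _).unique h (by simp; omega)
    have h2 : (l'.drop (l'.length - (l.length + 1))).count none ≤ l'.count none :=
      (List.drop_sublist _ _).count_le _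
    rw [h1, List.count_cons_self] at h2
    omega
  have h1 := key l l' h h' hc
  have h2 := key l' l h' h hc.symm
  exact h.1.unique h'.1 (by omega)

theorem exists_run_count (hx : ∀ x, ∃ y, Tendsto (χ x y) atTop atTop) (m : ℕ) :
    ∃ l, l.count none = m ∧ Run χ (none :: l) := by
  have step : ∀ l : List Outcome, Run χ l →
      ∃ l', l'.count none = l.count none ∧ Run χ (none :: l') := by
    intro l hl
    by_contra hc
    push Not at hc
    have hall : ∀ n ≥ l.length, ∃ l', l'.length = n ∧ Run χ l' ∧
        l'.count none = l.count none := by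
      intro n hn
      induction n, hn using Nat.le_induction with
      | base => exact ⟨l, rfl, hl, rfl⟩
      | succ n hn ih =>
        obtain ⟨l', h1, h2, h3⟩ := ih
        obtain ⟨o, ho⟩ := exists_correct (seqAt χ l')
        rcases o with _ | o
        · exact absurd ⟨h2, ho⟩ (hc l' h3)
        · exact ⟨some o :: l', by simp [h1], ⟨h2, ho⟩, by simpa using h3⟩
    obtain ⟨y, hy⟩ := hx (l.count none)
    obtain ⟨l', h1, h2, h3⟩ := hall (Nat.pair y l.length) (Nat.right_le_pair _ _)
    refine hc l' h3 ⟨h2, ?_⟩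
    change Tendsto (χ (l'.count none) (Nat.unpair l'.length).1) atTop atTop
    rw [h1, h3]
    simpa using hy
  induction m with
  | zero => exact step [] trivial
  | succ m ih =>
    obtain ⟨l, h1, h2⟩ := ih
    obtain ⟨l', h3, h4⟩ := step (none :: l) h2
    exact ⟨l', by rw [h3, List.count_cons_self, h1], h4⟩

end

/-- The outcomes coded by `q`. -/
def outcomes (q : ℕ) : List Outcome := Denumerable.ofNat (List Outcome) q

theorem finite_run {χ : ℕ → ℕ → ℕ → ℕ} {x : ℕ} (hx : ∀ y, ¬ Tendsto (χ x y) atTop atTop) :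
    {q | Run χ (none :: outcomes q)}.Finite := by
  refine Set.Finite.of_finite_image (f := fun q => (outcomes q).count none)
    ((Set.finite_Iic x).subset ?_) ?_
  · rintro _ ⟨q, hq, rfl⟩
    exact Run.count_lt hx hq.1
  · intro q hq q' hq' h
    have := Run.eq_of_count_eq hq hq' h
    exact (Denumerable.eqv (List Outcome)).symm.injective this

/-- Stage-wise refutation of `Run`. -/
def refuteRun (χ : ℕ → ℕ → ℕ → ℕ) (l : List Outcome) (z t : ℕ) : Prop :=
  ∃ o ∈ l[(Nat.unpair z).1]?,
    refute (seqAt χ (l.drop ((Nat.unpair z).1 + 1))) o (Nat.unpair z).2 t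

theorem run_iff_finite (χ : ℕ → ℕ → ℕ → ℕ) (l : List Outcome) :
    Run χ l ↔ ∀ z, {t | refuteRun χ l z t}.Finite := by
  rw [run_iff]
  constructor
  · intro h z
    cases ho : l[(Nat.unpair z).1]? with
    | none => simp [refuteRun, ho]
    | some o =>
      have := (correct_iff _ _).1 (h _ _ ho) (Nat.unpair z).2
      simpa [refuteRun, ho] using this
  · intro h i o ho
    rw [correct_iff]
    intro b
    have := h (Nat.pair i b)
    simpa [refuteRun, ho] using this

end Guide

section PrimrecTools

variable {α β : Type*} [Primcodable α] [Primcodable β]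

theorem PrimrecPred.exists_mem_option {o : α → Option β} {Q : α → β → Prop} (ho : Primrec o)
    (hQ : PrimrecPred fun p : α × β => Q p.1 p.2) : PrimrecPred fun a => ∃ u ∈ o a, Q a u := by
  classical
  refine ⟨Classical.decPred _, (Primrec.option_casesOn ho (Primrec.const false)
    (g := fun a u => decide (Q a u)) hQ.decide.to₂).of_eq fun a => ?_⟩
  cases h : o a <;> simp [h]

theorem PrimrecPred.forall_lt_of {f : α → ℕ} {Q : α → ℕ → Prop} (hf : Primrec f)
    (hQ : PrimrecPred fun p : α × ℕ => Q p.1 p.2) : PrimrecPred fun a => ∀ x < f a, Q a x := by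
  have h : PrimrecRel fun (x : ℕ) (a : α) => Q a x :=
    hQ.comp (Primrec.pair Primrec.snd Primrec.fst)
  exact (h.forall_mem_list.comp (Primrec.list_range.comp hf) Primrec.id).of_eq (by simp)

theorem PrimrecPred.forall_mem_list_of {f : α → List β} {Q : α → β → Prop} (hf : Primrec f)
    (hQ : PrimrecPred fun p : α × β => Q p.1 p.2) : PrimrecPred fun a => ∀ x ∈ f a, Q a x := by
  have h : PrimrecRel fun (x : β) (a : α) => Q a x :=
    hQ.comp (Primrec.pair Primrec.snd Primrec.fst)
  exact h.forall_mem_list.comp hf Primrec.id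

theorem PrimrecPred.exists_mem_list_of {f : α → List β} {Q : α → β → Prop} (hf : Primrec f)
    (hQ : PrimrecPred fun p : α × β => Q p.1 p.2) : PrimrecPred fun a => ∃ x ∈ f a, Q a x := by
  have h : PrimrecRel fun (x : β) (a : α) => Q a x :=
    hQ.comp (Primrec.pair Primrec.snd Primrec.fst)
  exact h.exists_mem_list.comp hf Primrec.id

theorem PrimrecPred.bool_eq_true {f : α → Bool} (hf : Primrec f) :
    PrimrecPred fun a => f a = true :=
  Primrec.eq.comp hf (Primrec.const true)

theorem Primrec.sample {act : α → ℕ → ℕ → Bool}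
    (h : Primrec fun p : α × ℕ × ℕ => act p.1 p.2.1 p.2.2) :
    Primrec fun p : α × ℕ => sample (act p.1) p.2 := by
  have hu : Primrec fun p : α × ℕ => Nat.unpair p.2 := Primrec.unpair.comp Primrec.snd
  exact Primrec.cond (h.comp (Primrec.pair Primrec.fst hu)) (Primrec.fst.comp hu) Primrec.snd

theorem Primrec.progress {r : α → ℕ → ℕ → Bool}
    (h : Primrec fun p : α × ℕ × ℕ => r p.1 p.2.1 p.2.2) :
    Primrec fun p : α × ℕ => progress (r p.1) p.2 := by
  have h2 : Primrec fun x : (α × ℕ) × ℕ × ℕ => x.2.2 := Primrec.snd.comp Primrec.snd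
  have hstep : Primrec₂ fun (p : α × ℕ) (s : ℕ × ℕ) =>
      bif r p.1 s.2 (Nat.unpair s.1).1 then s.2 + 1 else s.2 := by
    refine Primrec.cond (h.comp (Primrec.pair (Primrec.fst.comp Primrec.fst)
      (Primrec.pair h2 (Primrec.fst.comp (Primrec.unpair.comp
        (Primrec.fst.comp Primrec.snd)))))) (Primrec.succ.comp h2) h2
  refine (Primrec.nat_rec' Primrec.snd (Primrec.const 0) hstep).of_eq fun p => ?_
  obtain ⟨a, t⟩ := p
  induction t with
  | zero => rfl
  | succ t ih => simp only at ih ⊢; rw [progress_succ, ← ih]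

theorem Primrec.list_count [BEq β] [LawfulBEq β] (b : β) : Primrec fun l : List β => l.count b := by
  have h : PrimrecPred fun x : β => x = b := Primrec.eq.comp Primrec.id (Primrec.const b)
  classical
  refine (Primrec.list_length.comp (Primrec.listFilter h)).of_eq fun l => ?_
  rw [List.count_eq_length_filter]
  refine congrArg List.length (List.filter_congr fun x _ => ?_)
  rw [Bool.eq_iff_iff, decide_eq_true_eq, beq_iff_eq]

end PrimrecTools

namespace Guide

section

variable {α : Type*} [Primcodable α]

theorem primrecPred_refute {κ : α → ℕ → ℕ} (hκ : Primrec fun p : α × ℕ => κ p.1 p.2) :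
    PrimrecPred fun p : α × Outcome × ℕ × ℕ => refute (κ p.1) p.2.1 p.2.2.1 p.2.2.2 := by
  have ho : Primrec fun p : α × Outcome × ℕ × ℕ => p.2.1 := Primrec.fst.comp Primrec.snd
  have hb : Primrec fun p : α × Outcome × ℕ × ℕ => p.2.2.1 :=
    Primrec.fst.comp (Primrec.snd.comp Primrec.snd)
  have ht : Primrec fun p : α × Outcome × ℕ × ℕ => p.2.2.2 :=
    Primrec.snd.comp (Primrec.snd.comp Primrec.snd)
  have hκ' : ∀ {γ : Type _} [Primcodable γ] {f : γ → α × Outcome × ℕ × ℕ} {g : γ → ℕ},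
      Primrec f → Primrec g → Primrec fun c => κ (f c).1 (g c) := fun hf hg =>
    hκ.comp (Primrec.pair (Primrec.fst.comp hf) hg)
  refine PrimrecPred.or (PrimrecPred.and (Primrec.eq.comp ho (Primrec.const none))
    (Primrec.nat_le.comp (hκ' Primrec.id ht) hb)) ?_
  refine PrimrecPred.exists_mem_option ho (Q := fun p u => (∀ t' < p.2.2.2, t' < p.2.2.1 ∨
    u.1 < κ p.1 t') ∨ (u.2 ≤ p.2.2.1 ∧ κ p.1 p.2.2.1 < u.1) ∨
      (u.2 ≠ 0 ∧ u.1 ≤ κ p.1 (u.2 - 1))) ?_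
  have hp : Primrec fun x : (α × Outcome × ℕ × ℕ) × ℕ × ℕ => x.1 := Primrec.fst
  have h1 : Primrec fun x : (α × Outcome × ℕ × ℕ) × ℕ × ℕ => x.2.1 := Primrec.fst.comp Primrec.snd
  have h2 : Primrec fun x : (α × Outcome × ℕ × ℕ) × ℕ × ℕ => x.2.2 := Primrec.snd.comp Primrec.snd
  refine PrimrecPred.or ?_ (PrimrecPred.or ?_ ?_)
  · refine PrimrecPred.forall_lt_of (ht.comp hp)
      (Q := fun x t' => t' < x.1.2.2.1 ∨ x.2.1 < κ x.1.1 t') ?_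
    exact PrimrecPred.or (Primrec.nat_lt.comp Primrec.snd (hb.comp (hp.comp Primrec.fst)))
      (Primrec.nat_lt.comp (h1.comp Primrec.fst) (hκ' (hp.comp Primrec.fst) Primrec.snd))
  · exact PrimrecPred.and (Primrec.nat_le.comp h2 (hb.comp hp))
      (Primrec.nat_lt.comp (hκ' hp (hb.comp hp)) h1)
  · exact PrimrecPred.and (PrimrecPred.not (Primrec.eq.comp h2 (Primrec.const 0)))
      (Primrec.nat_le.comp h1 (hκ' hp (Primrec.pred.comp h2)))

theorem primrec_seqAt {χ : α → ℕ → ℕ → ℕ → ℕ}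
    (hχ : Primrec fun p : α × ℕ × ℕ × ℕ => χ p.1 p.2.1 p.2.2.1 p.2.2.2) :
    Primrec fun p : (α × List Outcome) × ℕ => seqAt (χ p.1.1) p.1.2 p.2 := by
  have hl : Primrec fun p : (α × List Outcome) × ℕ => p.1.2 := Primrec.snd.comp Primrec.fst
  exact hχ.comp (Primrec.pair (Primrec.fst.comp Primrec.fst)
    (Primrec.pair ((Primrec.list_count none).comp hl) (Primrec.pair
      (Primrec.fst.comp (Primrec.unpair.comp (Primrec.list_length.comp hl))) Primrec.snd)))

theorem primrecPred_refuteRun {χ : α → ℕ → ℕ → ℕ → ℕ}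
    (hχ : Primrec fun p : α × ℕ × ℕ × ℕ => χ p.1 p.2.1 p.2.2.1 p.2.2.2) :
    PrimrecPred fun p : (α × List Outcome) × ℕ × ℕ =>
      refuteRun (χ p.1.1) p.1.2 p.2.1 p.2.2 := by
  have ha : Primrec fun p : (α × List Outcome) × ℕ × ℕ => p.1.1 := Primrec.fst.comp Primrec.fst
  have hl : Primrec fun p : (α × List Outcome) × ℕ × ℕ => p.1.2 := Primrec.snd.comp Primrec.fst
  have hz : Primrec fun p : (α × List Outcome) × ℕ × ℕ => Nat.unpair p.2.1 :=
    Primrec.unpair.comp (Primrec.fst.comp Primrec.snd)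
  have ht : Primrec fun p : (α × List Outcome) × ℕ × ℕ => p.2.2 := Primrec.snd.comp Primrec.snd
  refine PrimrecPred.exists_mem_option (Primrec.list_getElem?.comp hl (Primrec.fst.comp hz))
    (Q := fun p o => refute (seqAt (χ p.1.1) (p.1.2.drop ((Nat.unpair p.2.1).1 + 1))) o
      (Nat.unpair p.2.1).2 p.2.2) ?_
  have hdrop : Primrec fun p : (α × List Outcome) × ℕ × ℕ =>
      p.1.2.drop ((Nat.unpair p.2.1).1 + 1) :=
    Primrec.list_drop.comp (Primrec.succ.comp (Primrec.fst.comp hz)) hl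
  exact (primrecPred_refute (κ := fun a : α × List Outcome => seqAt (χ a.1) a.2)
    (primrec_seqAt hχ)).comp
    (f := fun x : ((α × List Outcome) × ℕ × ℕ) × Outcome =>
      ((x.1.1.1, x.1.1.2.drop ((Nat.unpair x.1.2.1).1 + 1)), x.2,
        (Nat.unpair x.1.2.1).2, x.1.2.2))
    (Primrec.pair (Primrec.pair (ha.comp Primrec.fst) (hdrop.comp Primrec.fst))
      (Primrec.pair Primrec.snd (Primrec.pair (Primrec.snd.comp (hz.comp Primrec.fst))
        (ht.comp Primrec.fst))))

end

end Guide

theorem IsSigma5.exists_primrec {P : Set ℕ} (h : IsSigma5 P) :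
    ∃ r : ℕ × ℕ × ℕ → ℕ → ℕ → ℕ → Bool,
      Primrec (fun p : ((ℕ × ℕ × ℕ) × ℕ) × ℕ × ℕ => r p.1.1 p.1.2 p.2.1 p.2.2) ∧
      ∀ e, e ∈ P ↔ ∃ x, ∀ y, ∃ z, ∀ w, ∃ v, r (e, x, y) z w v = true := by
  obtain ⟨R, hR, hP⟩ := h
  obtain ⟨c, hc⟩ := Nat.Partrec.Code.exists_code.1 hR
  have heval : ∀ e x y z w v, c.eval (Encodable.encode (e, x, y, z, w, v)) =
      Part.some (Encodable.encode (R e x y z w v)) := by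
    intro e x y z w v
    rw [hc]
    simp
  refine ⟨fun a z w v => decide (Nat.Partrec.Code.evaln (Nat.unpair v).2 c
    (Encodable.encode (a.1, a.2.1, a.2.2, z, w, (Nat.unpair v).1)) =
      some (Encodable.encode true)), ?_, ?_⟩
  · refine PrimrecPred.decide (p := fun p : ((ℕ × ℕ × ℕ) × ℕ) × ℕ × ℕ =>
      Nat.Partrec.Code.evaln (Nat.unpair p.2.2).2 c (Encodable.encode (p.1.1.1, p.1.1.2.1,
        p.1.1.2.2, p.1.2, p.2.1, (Nat.unpair p.2.2).1)) = some (Encodable.encode true)) ?_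
    have hv : Primrec fun p : ((ℕ × ℕ × ℕ) × ℕ) × ℕ × ℕ => Nat.unpair p.2.2 :=
      Primrec.unpair.comp (Primrec.snd.comp Primrec.snd)
    have ha : Primrec fun p : ((ℕ × ℕ × ℕ) × ℕ) × ℕ × ℕ => p.1.1 := Primrec.fst.comp Primrec.fst
    refine Primrec.eq.comp (Nat.Partrec.Code.primrec_evaln.comp (Primrec.pair (Primrec.pair
      (Primrec.snd.comp hv) (Primrec.const c)) (Primrec.encode.comp ?_))) (Primrec.const _)
    exact Primrec.pair (Primrec.fst.comp ha) (Primrec.pair (Primrec.fst.comp (Primrec.snd.comp ha))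
      (Primrec.pair (Primrec.snd.comp (Primrec.snd.comp ha)) (Primrec.pair
        (Primrec.snd.comp Primrec.fst) (Primrec.pair (Primrec.fst.comp Primrec.snd)
          (Primrec.fst.comp hv)))))
  · intro e
    rw [hP]
    refine exists_congr fun x => forall_congr' fun y => exists_congr fun z =>
      forall_congr' fun w => ?_
    constructor
    · rintro ⟨v, hv⟩
      have h1 : Encodable.encode true ∈ c.eval (Encodable.encode (e, x, y, z, w, v)) := by
        rw [heval, hv]; exact Part.mem_some _
      obtain ⟨k, hk⟩ := Nat.Partrec.Code.evaln_complete.1 h1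
      refine ⟨Nat.pair v k, ?_⟩
      simpa using hk
    · rintro ⟨v, hv⟩
      have h1 := Nat.Partrec.Code.evaln_sound (of_decide_eq_true hv)
      rw [heval, Part.mem_some_iff] at h1
      exact ⟨_, (Encodable.encode_injective h1).symm⟩

open Classical in
/-- Normal form for `Σ⁰₅` sets in terms of convergence to infinity along a coded tree of
outcomes. -/
theorem IsSigma5.exists_level {P : Set ℕ} (h : IsSigma5 P) :
    ∃ (lev : ℕ → ℕ → ℕ → ℕ) (idx : ℕ → ℕ),
      Primrec (fun p : (ℕ × ℕ) × ℕ => lev p.1.1 p.1.2 p.2) ∧ Primrec idx ∧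
      (∀ e ∈ P, {q | Tendsto (lev e q) atTop atTop}.Finite) ∧
      ∀ e ∉ P, ∀ m, ∃ q, idx q = m ∧ Tendsto (lev e q) atTop atTop := by
  obtain ⟨r, hr, hP⟩ := h.exists_primrec
  let χ : ℕ → ℕ → ℕ → ℕ → ℕ := fun e x y => sample fun z t =>
    r (e, x, y) z (progress (r (e, x, y) z) t) (Nat.unpair t).1
  have hχ : Primrec fun p : ℕ × ℕ × ℕ × ℕ => χ p.1 p.2.1 p.2.2.1 p.2.2.2 := by
    have h1 : Primrec fun p : (ℕ × ℕ × ℕ) × ℕ × ℕ =>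
        r p.1 p.2.1 (progress (r p.1 p.2.1) p.2.2) (Nat.unpair p.2.2).1 := by
      have hp : Primrec fun p : (ℕ × ℕ × ℕ) × ℕ × ℕ => (p.1, p.2.1) :=
        Primrec.pair Primrec.fst (Primrec.fst.comp Primrec.snd)
      have ht : Primrec fun p : (ℕ × ℕ × ℕ) × ℕ × ℕ => p.2.2 := Primrec.snd.comp Primrec.snd
      have hpr := (Primrec.progress (r := fun b : (ℕ × ℕ × ℕ) × ℕ => r b.1 b.2) hr).comp
        (Primrec.pair hp ht)
      exact hr.comp (Primrec.pair hp (Primrec.pair hpr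
        (Primrec.fst.comp (Primrec.unpair.comp ht))))
    have h2 := Primrec.sample (act := fun (a : ℕ × ℕ × ℕ) z t =>
      r a z (progress (r a z) t) (Nat.unpair t).1) h1
    exact h2.comp (f := fun p : (ℕ × ℕ × ℕ) × ℕ =>
        sample (fun z t => r p.1 z (progress (r p.1 z) t) (Nat.unpair t).1) p.2)
      (g := fun p : ℕ × ℕ × ℕ × ℕ => ((p.1, p.2.1, p.2.2.1), p.2.2.2))
      (Primrec.pair (Primrec.pair Primrec.fst (Primrec.pair (Primrec.fst.comp Primrec.snd)
        (Primrec.fst.comp (Primrec.snd.comp Primrec.snd))))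
        (Primrec.snd.comp (Primrec.snd.comp Primrec.snd)))
  have hgood : ∀ e, e ∈ P ↔ ∃ x, ∀ y, ¬ Tendsto (χ e x y) atTop atTop := by
    intro e
    rw [hP]
    refine exists_congr fun x => forall_congr' fun y => ?_
    rw [tendsto_sample_iff]
    push Not
    refine exists_congr fun z => ?_
    exact (infinite_progress_iff (r (e, x, y) z)).symm
  refine ⟨fun e q => sample fun z t =>
    decide (Guide.refuteRun (χ e) (none :: Guide.outcomes q) z t),
    fun q => (Guide.outcomes q).count none, ?_, ?_, ?_, ?_⟩
  · have hq : Primrec fun a : ℕ × ℕ => (none :: Guide.outcomes a.2 : List Guide.Outcome) :=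
      Primrec.list_cons.comp (Primrec.const none) ((Primrec.ofNat (List Guide.Outcome)).comp
        Primrec.snd)
    refine Primrec.sample (act := fun (a : ℕ × ℕ) z t =>
      decide (Guide.refuteRun (χ a.1) (none :: Guide.outcomes a.2) z t)) ?_
    refine PrimrecPred.decide (p := fun p : (ℕ × ℕ) × ℕ × ℕ =>
      Guide.refuteRun (χ p.1.1) (none :: Guide.outcomes p.1.2) p.2.1 p.2.2) ?_
    exact (Guide.primrecPred_refuteRun hχ).comp
      (f := fun p : (ℕ × ℕ) × ℕ × ℕ => ((p.1.1, none :: Guide.outcomes p.1.2), p.2))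
      (Primrec.pair (Primrec.pair (Primrec.fst.comp Primrec.fst) (hq.comp Primrec.fst))
        Primrec.snd)
  · exact (Primrec.list_count none).comp (Primrec.ofNat (List Guide.Outcome))
  · intro e he
    obtain ⟨x, hx⟩ := (hgood e).1 he
    refine (Guide.finite_run hx).subset fun q hq => ?_
    have hq' := (tendsto_sample_iff _).1 hq
    simp only [decide_eq_true_eq] at hq'
    exact (Guide.run_iff_finite _ _).2 hq'
  · intro e he m
    rw [hgood] at he
    push Not at he
    obtain ⟨l, hl, hrun⟩ := Guide.exists_run_count he m
    refine ⟨Encodable.encode l, ?_, ?_⟩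
    · simpa [Guide.outcomes] using hl
    · rw [tendsto_sample_iff]
      simp only [decide_eq_true_eq]
      rw [← Guide.run_iff_finite]
      simpa [Guide.outcomes] using hrun

namespace Marker

/-- The candidate `(p, ρ, k)` examined at stage `t`. -/
def cand (t : ℕ) : ℕ × List ℕ × ℕ := Denumerable.ofNat (ℕ × List ℕ × ℕ) (Nat.unpair t).1

/-- The `n`-th finite sequence. -/
def seqCode (n : ℕ) : List ℕ := Denumerable.ofNat (List ℕ) n

/-- The subsequence of `σ` that avoids the entries of `v`. -/
def avoid (v σ : List ℕ) : List ℕ := σ.filter (fun a => decide (a ∉ v))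

/-- One stage of the marker construction. -/
def step (cert : List ℕ → ℕ → ℕ → Bool) (b t : ℕ) (s : List ℕ × ℕ) : List ℕ × ℕ :=
  if (cand t).1 ∈ (((s.1 ++ [t + 1]).take b).drop (min s.2 b)) ∧
      (∀ a ∈ seqCode (min s.2 b) ++ (cand t).2.1, a ≤ t + 1) ∧
      cert (avoid (((s.1 ++ [t + 1]).take b).take (min s.2 b) ++ [(cand t).1])
        (seqCode (min s.2 b) ++ (cand t).2.1)) (cand t).1 (cand t).2.2 = true then
    (((s.1 ++ [t + 1]).take b).take (min s.2 b) ++ [(cand t).1], min s.2 b + 1)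
  else ((s.1 ++ [t + 1]).take b, min s.2 b)

/-- The state of the marker construction before stage `t`: the list of white numbers
and the number of fixed markers. -/
def state (lev : ℕ → ℕ) (cert : List ℕ → ℕ → ℕ → Bool) : ℕ → List ℕ × ℕ
  | 0 => ([], 0)
  | t + 1 => step cert (lev t) t (state lev cert t)

theorem exists_ge_unpair_fst (c T : ℕ) : ∃ t ≥ T, (Nat.unpair t).1 = c :=
  ⟨Nat.pair c T, Nat.right_le_pair c T, by simp⟩

theorem step_cases (cert : List ℕ → ℕ → ℕ → Bool) (b t : ℕ) (s : List ℕ × ℕ) :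
    (∃ p ρ k, p ∈ (((s.1 ++ [t + 1]).take b).drop (min s.2 b)) ∧
      (∀ a ∈ seqCode (min s.2 b) ++ ρ, a ≤ t + 1) ∧
      cert (avoid (((s.1 ++ [t + 1]).take b).take (min s.2 b) ++ [p])
        (seqCode (min s.2 b) ++ ρ)) p k = true ∧
      step cert b t s = (((s.1 ++ [t + 1]).take b).take (min s.2 b) ++ [p], min s.2 b + 1)) ∨
    step cert b t s = ((s.1 ++ [t + 1]).take b, min s.2 b) := by
  unfold step
  split_ifs with h
  · exact Or.inl ⟨_, _, _, h.1, h.2.1, h.2.2, rfl⟩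
  · exact Or.inr rfl

theorem step_sublist (cert : List ℕ → ℕ → ℕ → Bool) (b t : ℕ) (s : List ℕ × ℕ) :
    ((step cert b t s).1).Sublist ((s.1 ++ [t + 1]).take b) := by
  rcases step_cases cert b t s with ⟨p, ρ, k, hp, -, -, h⟩ | h
  · rw [h]
    conv_rhs => rw [← List.take_append_drop (min s.2 b) ((s.1 ++ [t + 1]).take b)]
    exact (List.Sublist.refl _).append (List.singleton_sublist.2 hp)
  · rw [h]

theorem length_step_le (cert : List ℕ → ℕ → ℕ → Bool) (b t : ℕ) (s : List ℕ × ℕ) :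
    ((step cert b t s).1).length ≤ b :=
  (step_sublist cert b t s).length_le.trans (by simp)

section

variable (lev : ℕ → ℕ) (cert : List ℕ → ℕ → ℕ → Bool)

/-- The list of white numbers before stage `t`. -/
def ws (t : ℕ) : List ℕ := (state lev cert t).1

/-- The number of fixed markers before stage `t`. -/
def num (t : ℕ) : ℕ := (state lev cert t).2

theorem ws_succ (t : ℕ) : ws lev cert (t + 1) = (step cert (lev t) t (state lev cert t)).1 := rfl

theorem num_succ (t : ℕ) : num lev cert (t + 1) = (step cert (lev t) t (state lev cert t)).2 := rfl

theorem ws_succ_sublist_take (t : ℕ) :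
    (ws lev cert (t + 1)).Sublist ((ws lev cert t ++ [t + 1]).take (lev t)) :=
  step_sublist _ _ _ _

theorem ws_succ_sublist (t : ℕ) :
    (ws lev cert (t + 1)).Sublist (ws lev cert t ++ [t + 1]) :=
  (ws_succ_sublist_take lev cert t).trans (List.take_sublist _ _)

theorem length_ws_succ_le (t : ℕ) : (ws lev cert (t + 1)).length ≤ lev t :=
  length_step_le _ _ _ _

theorem ws_zero : ws lev cert 0 = [] := rfl

theorem num_zero : num lev cert 0 = 0 := rfl

theorem mem_ws_bounds (t : ℕ) : ∀ x ∈ ws lev cert t, 1 ≤ x ∧ x ≤ t := by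
  induction t with
  | zero => simp [ws_zero]
  | succ t ih =>
    intro x hx
    have := (ws_succ_sublist lev cert t).subset hx
    rcases List.mem_append.1 this with h | h
    · have := ih x h; omega
    · simp at h; omega

theorem nodup_ws (t : ℕ) : (ws lev cert t).Nodup := by
  induction t with
  | zero => simp [ws_zero]
  | succ t ih =>
    refine (ws_succ_sublist lev cert t).nodup ?_
    rw [List.nodup_append]
    refine ⟨ih, by simp, ?_⟩
    intro a ha b hb
    have := mem_ws_bounds lev cert t a ha
    simp at hb
    omega

theorem num_le_length (t : ℕ) : num lev cert t ≤ (ws lev cert t).length := by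
  induction t with
  | zero => simp [num_zero]
  | succ t ih =>
    rw [num_succ, ws_succ]
    unfold ws num at ih
    rcases step_cases cert (lev t) t (state lev cert t) with ⟨p, ρ, k, hp, -, -, h⟩ | h
    · rw [h]; simp; omega
    · rw [h]; simp; omega

theorem not_mem_ws_mono {t x : ℕ} (hx : x ≤ t) (h : x ∉ ws lev cert t) {s : ℕ} (hs : t ≤ s) :
    x ∉ ws lev cert s := by
  induction s, hs using Nat.le_induction with
  | base => exact h
  | succ s hs ih =>
    intro hx'
    rcases List.mem_append.1 ((ws_succ_sublist lev cert s).subset hx') with h | h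
    · exact ih h
    · simp at h; omega

theorem take_succ_of_le {t j : ℕ} (hj : j ≤ num lev cert t) (hl : j ≤ lev t) :
    j ≤ num lev cert (t + 1) ∧ (ws lev cert (t + 1)).take j = (ws lev cert t).take j := by
  have hlen := num_le_length lev cert t
  rw [num_succ, ws_succ]
  unfold ws num at *
  rcases step_cases cert (lev t) t (state lev cert t) with ⟨p, ρ, k, hp, -, -, h⟩ | h
  · rw [h]
    refine ⟨by simp; omega, ?_⟩
    rw [List.take_append_of_le_length (by simp; omega), List.take_take, List.take_take,
      List.take_append_of_le_length (by omega)]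
    congr 1; omega
  · rw [h]
    refine ⟨by simp; omega, ?_⟩
    simp only
    rw [List.take_take, List.take_append_of_le_length (by omega)]
    congr 1; omega

theorem ws_succ_subset_of_lt {t j : ℕ} (hj : j ≤ num lev cert t) (hl : lev t < j) :
    ws lev cert (t + 1) ⊆ (ws lev cert t).take (j - 1) := by
  have hlen := num_le_length lev cert t
  have h := (ws_succ_sublist_take lev cert t).subset
  rw [List.take_append_of_le_length (by omega)] at h
  exact fun x hx => List.take_subset_take_left _ (by omega) (h hx)

/-- The base set of the family. -/
def base : Set ℕ := {x | ∃ t ≥ x, x ∉ ws lev cert t}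

/-- The `j`-th further member of the family. -/
def layer (j : ℕ) : Set ℕ :=
  base lev cert ∪ {x | ∃ t ≥ x, j ≤ num lev cert t ∧ x ∉ (ws lev cert t).take j}

theorem base_subset_layer (j : ℕ) : base lev cert ⊆ layer lev cert j := Set.subset_union_left

theorem zero_mem_base : 0 ∈ base lev cert := ⟨0, le_rfl, by simp [ws_zero]⟩

variable {lev cert} in
theorem eventually_not_mem_of_mem_base {x : ℕ} (h : x ∈ base lev cert) :
    ∃ T, ∀ t ≥ T, x ∉ ws lev cert t := by
  obtain ⟨t, ht, hx⟩ := h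
  exact ⟨t, fun s hs => not_mem_ws_mono lev cert ht hx hs⟩

variable {lev cert} in
theorem not_mem_base_of_forall {x T : ℕ} (h : ∀ t ≥ T, x ∈ ws lev cert t) :
    x ∉ base lev cert := by
  intro hx
  obtain ⟨T', hT'⟩ := eventually_not_mem_of_mem_base hx
  exact hT' (max T T') (le_max_right _ _) (h _ (le_max_left _ _))

theorem stable_or_mem_base {t j : ℕ} (hj : j ≤ num lev cert t) :
    (∀ t' ≥ t, j ≤ num lev cert t' ∧ (ws lev cert t').take j = (ws lev cert t).take j) ∨
    (∀ x ≤ t, x ∉ (ws lev cert t).take (j - 1) → x ∈ base lev cert) := by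
  have key : ∀ t' ≥ t, (∀ r, t ≤ r → r < t' → j ≤ lev r) →
      j ≤ num lev cert t' ∧ (ws lev cert t').take j = (ws lev cert t).take j := by
    intro t' ht'
    induction t', ht' using Nat.le_induction with
    | base => exact fun _ => ⟨hj, rfl⟩
    | succ s hs ih =>
      intro h
      obtain ⟨h1, h2⟩ := ih (fun r hr hr' => h r hr (by omega))
      obtain ⟨h3, h4⟩ := take_succ_of_le lev cert h1 (h s hs (by omega))
      exact ⟨h3, h4.trans h2⟩
  by_cases hf : ∃ r, t ≤ r ∧ lev r < j
  · right
    classical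
    have hspec := Nat.find_spec hf
    have hmin : ∀ r, t ≤ r → r < Nat.find hf → j ≤ lev r := by
      intro r hr hr'
      have := Nat.find_min hf hr'
      push Not at this
      exact this hr
    obtain ⟨h1, h2⟩ := key _ hspec.1 hmin
    intro x hx hxn
    refine ⟨Nat.find hf + 1, by omega, fun hmem => hxn ?_⟩
    have := ws_succ_subset_of_lt lev cert h1 hspec.2 hmem
    have h5 : (ws lev cert (Nat.find hf)).take (j - 1) = (ws lev cert t).take (j - 1) := by
      have := congrArg (List.take (j - 1)) h2
      simpa [List.take_take] using this
    rwa [h5] at this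
  · left
    push Not at hf
    exact fun t' ht' => key t' ht' (fun r hr _ => hf r hr)

theorem layer_eq_compl {T j : ℕ} {l : List ℕ}
    (h : ∀ t ≥ T, j ≤ num lev cert t ∧ (ws lev cert t).take j = l) :
    layer lev cert j = {x | x ∉ l} := by
  have hb : ∀ x ∈ base lev cert, x ∉ l := by
    intro x hx hxl
    refine not_mem_base_of_forall (T := T) (fun t ht => ?_) hx
    rw [← (h t ht).2] at hxl
    exact List.mem_of_mem_take hxl
  ext x
  constructor
  · rintro (hx | ⟨t, ht, hj, hx⟩)
    · exact hb x hx
    · rcases stable_or_mem_base lev cert hj with hs | hs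
      · have h1 := (hs (max t T) (le_max_left _ _)).2
        rw [(h (max t T) (le_max_right _ _)).2] at h1
        simpa [h1] using hx
      · refine hb x (hs x ht fun hx' => hx ?_)
        exact List.take_subset_take_left _ (by omega) hx'
  · intro hx
    refine Or.inr ⟨max x T, le_max_left _ _, (h _ (le_max_right _ _)).1, ?_⟩
    rw [(h _ (le_max_right _ _)).2]
    exact hx

theorem layer_eq_base_or (j : ℕ) : layer lev cert j = base lev cert ∨
    ∃ T l, (∀ t ≥ T, j ≤ num lev cert t ∧ (ws lev cert t).take j = l) := by
  by_cases h : ∃ T, j ≤ num lev cert T ∧ ∀ t ≥ T, j ≤ num lev cert t ∧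
      (ws lev cert t).take j = (ws lev cert T).take j
  · obtain ⟨T, -, hT⟩ := h
    exact Or.inr ⟨T, _, hT⟩
  · left
    refine Set.Subset.antisymm ?_ (base_subset_layer lev cert j)
    rintro x (hx | ⟨t, ht, hj, hx⟩)
    · exact hx
    · rcases stable_or_mem_base lev cert hj with hs | hs
      · exact absurd ⟨t, hj, hs⟩ h
      · exact hs x ht fun hx' => hx (List.take_subset_take_left _ (by omega) hx')

end

section

variable (lev : ℕ → ℕ) (cert : List ℕ → ℕ → ℕ → Bool)

theorem cert_of_lt_num (t : ℕ) : ∀ i < num lev cert t, ∃ p ρ k,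
    (ws lev cert t)[i]? = some p ∧
    (∀ a ∈ avoid ((ws lev cert t).take (i + 1)) (seqCode i ++ ρ), a ≤ t ∧ a ∉ ws lev cert t) ∧
    cert (avoid ((ws lev cert t).take (i + 1)) (seqCode i ++ ρ)) p k = true := by
  induction t with
  | zero => simp [num_zero]
  | succ t ih =>
    have hlen := num_le_length lev cert t
    have old : ∀ i < min (num lev cert t) (lev t), i < num lev cert (t + 1) → ∃ p ρ k,
        (ws lev cert (t + 1))[i]? = some p ∧
        (∀ a ∈ avoid ((ws lev cert (t + 1)).take (i + 1)) (seqCode i ++ ρ),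
          a ≤ t + 1 ∧ a ∉ ws lev cert (t + 1)) ∧
        cert (avoid ((ws lev cert (t + 1)).take (i + 1)) (seqCode i ++ ρ)) p k = true := by
      intro i hi _
      obtain ⟨p, ρ, k, h1, h2, h3⟩ := ih i (by omega)
      have ht := (take_succ_of_le lev cert (t := t) (j := i + 1) (by omega) (by omega)).2
      refine ⟨p, ρ, k, ?_, ?_, ?_⟩
      · rw [← h1, ← List.getElem?_take_of_lt (Nat.lt_succ_self i), ← Nat.add_one, ht,
          List.getElem?_take_of_lt (Nat.lt_succ_self i)]
      · rw [ht]
        intro a ha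
        have := h2 a ha
        exact ⟨by omega, not_mem_ws_mono lev cert this.1 this.2 (Nat.le_succ t)⟩
      · rwa [ht]
    intro i hi
    by_cases hio : i < min (num lev cert t) (lev t)
    · exact old i hio hi
    · rw [num_succ] at hi
      rw [ws_succ]
      unfold ws num at *
      rcases step_cases cert (lev t) t (state lev cert t) with ⟨p, ρ, k, hp, h1, h2, h⟩ | h
      · rw [h] at hi ⊢
        have hi' : i = min (state lev cert t).2 (lev t) := by simp at hi hio; omega
        subst hi'
        set n := min (state lev cert t).2 (lev t) with hn
        have hl : ((((state lev cert t).1 ++ [t + 1]).take (lev t)).take n).length = n := by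
          simp; omega
        have htake : ((((state lev cert t).1 ++ [t + 1]).take (lev t)).take n ++ [p]).take (n + 1)
            = (((state lev cert t).1 ++ [t + 1]).take (lev t)).take n ++ [p] := by
          apply List.take_of_length_le
          simp
        refine ⟨p, ρ, k, ?_, ?_, ?_⟩
        · rw [List.getElem?_append_right (by omega), hl]; simp
        · simp only [htake]
          intro a ha
          simp only [avoid, List.mem_filter, decide_eq_true_eq] at ha
          exact ⟨h1 a ha.1, ha.2⟩
        · simp only [htake]; exact h2
      · rw [h] at hi; exact absurd hi hio

/-- The `j`-th marker is eventually fixed forever. -/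
def Fixed (j : ℕ) : Prop := ∃ T, ∀ t ≥ T, j ≤ num lev cert t

variable {lev cert}

theorem Fixed.mono {i j : ℕ} (h : Fixed lev cert j) (hij : i ≤ j) : Fixed lev cert i :=
  h.imp fun _ hT t ht => hij.trans (hT t ht)

theorem fixed_zero : Fixed lev cert 0 := ⟨0, fun _ _ => Nat.zero_le _⟩

variable (hbad : Tendsto lev atTop atTop)
include hbad

theorem Fixed.take_eq {j : ℕ} (h : Fixed lev cert j) :
    ∃ T l, l.length = j ∧ ∀ t ≥ T, j ≤ lev t ∧ j ≤ num lev cert t ∧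
      (ws lev cert t).take j = l := by
  obtain ⟨T, hT⟩ := h
  obtain ⟨T', hT'⟩ := eventually_atTop.1 (hbad.eventually_ge_atTop j)
  refine ⟨max T T', (ws lev cert (max T T')).take j, ?_, ?_⟩
  · have := num_le_length lev cert (max T T')
    have := hT _ (le_max_left T T')
    simp; omega
  · intro t ht
    refine ⟨hT' t (le_trans (le_max_right _ _) ht), hT t (le_trans (le_max_left _ _) ht), ?_⟩
    induction t, ht using Nat.le_induction with
    | base => rfl
    | succ s hs ih =>
      rw [← ih]
      exact (take_succ_of_le lev cert (hT s (le_trans (le_max_left _ _) hs))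
        (hT' s (le_trans (le_max_right _ _) hs))).2

theorem eventually_num_lt {j : ℕ} (h : ¬ Fixed lev cert j) :
    ∃ T, ∀ t ≥ T, num lev cert t < j := by
  obtain ⟨T, hT⟩ := eventually_atTop.1 (hbad.eventually_ge_atTop j)
  refine ⟨T, fun t ht => ?_⟩
  by_contra hc
  refine h ⟨t, fun s hs => ?_⟩
  induction s, hs using Nat.le_induction with
  | base => omega
  | succ s hs ih => exact (take_succ_of_le lev cert ih (hT s (ht.le.trans hs))).1

omit hbad in
theorem exists_stuck {j : ℕ} (h : ¬ Fixed lev cert j) :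
    ∃ n < j, Fixed lev cert n ∧ ¬ Fixed lev cert (n + 1) := by
  induction j with
  | zero => exact absurd fixed_zero h
  | succ j ih =>
    by_cases hj : Fixed lev cert j
    · exact ⟨j, by omega, hj, h⟩
    · obtain ⟨n, hn, h'⟩ := ih hj
      exact ⟨n, by omega, h'⟩

theorem eventually_num_eq {n : ℕ} (h : Fixed lev cert n) (h' : ¬ Fixed lev cert (n + 1)) :
    ∃ T l, l.length = n ∧ ∀ t ≥ T, n ≤ lev t ∧ num lev cert t = n ∧
      (ws lev cert t).take n = l := by
  obtain ⟨T, l, hl, hT⟩ := h.take_eq hbad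
  obtain ⟨T', hT'⟩ := eventually_num_lt hbad h'
  refine ⟨max T T', l, hl, fun t ht => ?_⟩
  obtain ⟨h1, h2, h3⟩ := hT t (le_trans (le_max_left _ _) ht)
  have := hT' t (le_trans (le_max_right _ _) ht)
  exact ⟨h1, by omega, h3⟩

theorem eventually_take_eq (j : ℕ) :
    ∃ T l, l.length = j ∧ ∀ t ≥ T, (ws lev cert t).take j = l := by
  by_cases hj : Fixed lev cert j
  · obtain ⟨T, l, hl, hT⟩ := hj.take_eq hbad
    exact ⟨T, l, hl, fun t ht => (hT t ht).2.2⟩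
  · obtain ⟨n, -, hn, hn'⟩ := exists_stuck hj
    obtain ⟨T₁, l, -, hT₁⟩ := eventually_num_eq hbad hn hn'
    obtain ⟨T₂, hT₂⟩ := eventually_atTop.1 (hbad.eventually_ge_atTop j)
    have hstep : ∀ t ≥ max T₁ T₂,
        ws lev cert (t + 1) = (ws lev cert t ++ [t + 1]).take (lev t) := by
      intro t ht
      have h1 := (hT₁ t (le_trans (le_max_left _ _) ht))
      have h2 := (hT₁ (t + 1) (le_trans (le_trans (le_max_left _ _) ht) (Nat.le_succ t)))
      have h3 := h2.2.1
      rw [num_succ] at h3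
      rw [ws_succ]
      rcases step_cases cert (lev t) t (state lev cert t) with ⟨p, ρ, k, -, -, -, h⟩ | h
      · have h4 := h1.2.1
        have h5 := h1.1
        rw [h] at h3
        unfold num at h4
        simp at h3
        omega
      · rw [h]; rfl
    have hlen : ∀ k, min k j ≤ (ws lev cert (max T₁ T₂ + k)).length := by
      intro k
      induction k with
      | zero => simp
      | succ k ih =>
        have := hT₂ (max T₁ T₂ + k) (le_trans (le_max_right T₁ T₂) (Nat.le_add_right _ _))
        rw [← Nat.add_assoc, hstep _ (Nat.le_add_right _ _)]
        simp; omega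
    refine ⟨max T₁ T₂ + j, (ws lev cert (max T₁ T₂ + j)).take j, ?_, ?_⟩
    · have := hlen j
      simp at this ⊢; omega
    · intro t ht
      have hl : ∀ t ≥ max T₁ T₂ + j, j ≤ (ws lev cert t).length := by
        intro t ht
        obtain ⟨k, rfl⟩ := Nat.exists_eq_add_of_le (le_trans (Nat.le_add_right _ j) ht)
        have := hlen k
        have : j ≤ k := by omega
        omega
      induction t, ht using Nat.le_induction with
      | base => rfl
      | succ s hs ih =>
        have h1 := hl s hs
        have h2 := hT₂ s (le_trans (le_max_right T₁ T₂) (le_trans (Nat.le_add_right _ j) hs))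
        rw [hstep s (le_trans (Nat.le_add_right _ j) hs), List.take_take,
          List.take_append_of_le_length (by omega), min_eq_left h2, ih]

theorem exists_not_mem_base (X : List ℕ) : ∃ p, p ∉ base lev cert ∧ p ∉ X := by
  obtain ⟨T, l, hl, hT⟩ := eventually_take_eq (cert := cert) hbad (X.length + 1)
  have hnd : l.Nodup := by
    rw [← hT T le_rfl]
    exact (List.take_sublist _ _).nodup (nodup_ws lev cert T)
  have : ∃ p ∈ l, p ∉ X := by
    by_contra hc
    push Not at hc
    have := (hnd.subperm hc).length_le
    omega
  obtain ⟨p, hp, hpX⟩ := this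
  refine ⟨p, not_mem_base_of_forall (T := T) fun t ht => ?_, hpX⟩
  rw [← hT t ht] at hp
  exact List.mem_of_mem_take hp

omit hbad in
theorem not_mem_base_of_take {T j : ℕ} {l : List ℕ} (h : ∀ t ≥ T, (ws lev cert t).take j = l)
    {p : ℕ} (hp : p ∈ l) : p ∉ base lev cert :=
  not_mem_base_of_forall (T := T) fun t ht => by
    rw [← h t ht] at hp
    exact List.mem_of_mem_take hp

theorem not_locking
    (H : ∀ S : Set ℕ, (S = base lev cert ∨ ∃ j, S = layer lev cert j) →
      ∀ σ₀ : List ℕ, (∀ a ∈ σ₀, a ∈ S) → ∃ ρ : List ℕ, (∀ a ∈ ρ, a ∈ S) ∧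
        ∀ τ : List ℕ, (∀ a ∈ τ, a ∈ S) →
          ∀ p, (∃ k, cert (σ₀ ++ ρ ++ τ) p k = true) ↔ p ∈ S) : False := by
  by_cases hst : ∀ j, Fixed lev cert j
  · obtain ⟨σ, hσ, hlock⟩ := H _ (Or.inl rfl) [] (by simp)
    simp only [List.nil_append] at hlock
    obtain ⟨T, l, hl, hT⟩ := (hst (Encodable.encode σ + 1)).take_eq hbad
    obtain ⟨p, ρ, k, h1, h2, h3⟩ := cert_of_lt_num lev cert T (Encodable.encode σ)
      (hT T le_rfl).2.1
    have hseq : seqCode (Encodable.encode σ) = σ := by simp [seqCode]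
    have hlb : ∀ a ∈ l, a ∉ base lev cert := fun a ha =>
      not_mem_base_of_take (fun t ht => (hT t ht).2.2) ha
    rw [(hT T le_rfl).2.2, hseq] at h2 h3
    have hσf : avoid l σ = σ := by
      refine List.filter_eq_self.2 fun a ha => ?_
      simp only [decide_eq_true_eq]
      exact fun hal => hlb a hal (hσ a ha)
    have hsplit : avoid l (σ ++ ρ) = σ ++ avoid l ρ := by
      rw [avoid, List.filter_append]
      exact congrArg (· ++ _) hσf
    rw [hsplit] at h2 h3
    have hp : p ∈ base lev cert := by
      refine (hlock (avoid l ρ) (fun a ha => ?_) p).1 ⟨k, h3⟩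
      have := h2 a (List.mem_append_right _ ha)
      exact ⟨T, this.1, this.2⟩
    refine hlb p ?_ hp
    rw [← (hT T le_rfl).2.2]
    rw [← List.getElem?_take_of_lt (Nat.lt_succ_self _)] at h1
    exact List.mem_of_getElem? h1
  · push Not at hst
    obtain ⟨j, hj⟩ := hst
    obtain ⟨n, -, hn, hn'⟩ := exists_stuck hj
    obtain ⟨T, l, hl, hT⟩ := eventually_num_eq hbad hn hn'
    have hS : layer lev cert n = {x | x ∉ l} :=
      layer_eq_compl lev cert (T := T) fun t ht => ⟨(hT t ht).2.1.ge, (hT t ht).2.2⟩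
    obtain ⟨ρ, hρ, hlock⟩ := H _ (Or.inr ⟨n, rfl⟩) (avoid l (seqCode n)) (by
      intro a ha
      simp only [avoid, List.mem_filter, decide_eq_true_eq] at ha
      rw [hS]; exact ha.2)
    obtain ⟨p, hpb, hpX⟩ := exists_not_mem_base (cert := cert) hbad (l ++ (seqCode n ++ ρ))
    simp only [List.mem_append, not_or] at hpX
    obtain ⟨k, hk⟩ := (hlock [] (by simp) p).2 (by rw [hS]; exact hpX.1)
    have hτ : avoid (l ++ [p]) (seqCode n ++ ρ) = avoid l (seqCode n) ++ ρ ++ [] := by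
      rw [List.append_nil, avoid, List.filter_append]
      congr 1
      · refine List.filter_congr fun a ha => ?_
        have : a ≠ p := fun h => hpX.2.1 (h ▸ ha)
        simp [this]
      · refine List.filter_eq_self.2 fun a ha => ?_
        have h1 : a ≠ p := fun h => hpX.2.2 (h ▸ ha)
        have h2 : a ∉ l := by have := hρ a ha; rwa [hS] at this
        simp [h1, h2]
    obtain ⟨B, hB⟩ : ∃ B, ∀ a ∈ seqCode n ++ ρ, a ≤ B :=
      ⟨(seqCode n ++ ρ).sum, fun a ha => List.le_sum_of_mem ha⟩
    obtain ⟨t, ht, hc⟩ := exists_ge_unpair_fst (Encodable.encode (p, ρ, k)) (max T (max B p))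
    have hcand : cand t = (p, ρ, k) := by rw [cand, hc, Denumerable.ofNat_encode]
    have htT : T ≤ t := le_trans (le_max_left _ _) ht
    have htB : B ≤ t := le_trans (le_trans (le_max_left _ _) (le_max_right _ _)) ht
    have htp : p ≤ t := le_trans (le_trans (le_max_right _ _) (le_max_right _ _)) ht
    obtain ⟨h1, h2, h3⟩ := hT t htT
    have h4 := (hT (t + 1) (by omega)).2.1
    have hlen := num_le_length lev cert t
    rw [num_succ] at h4
    have hmin : min (state lev cert t).2 (lev t) = n := by
      change min (num lev cert t) _ = n
      omega
    have htake : (((state lev cert t).1 ++ [t + 1]).take (lev t)).take n = l := by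
      rw [List.take_take, min_eq_left h1, List.take_append_of_le_length
        (by change n ≤ (ws lev cert t).length; omega)]
      exact h3
    have hpu : p ∈ ((state lev cert t).1 ++ [t + 1]).take (lev t) := by
      refine (ws_succ_sublist_take lev cert t).subset ?_
      by_contra hpn
      exact hpb ⟨t + 1, by omega, hpn⟩
    have hpd : p ∈ (((state lev cert t).1 ++ [t + 1]).take (lev t)).drop n := by
      rw [← List.take_append_drop n (((state lev cert t).1 ++ [t + 1]).take (lev t)),
        List.mem_append, htake] at hpu
      exact hpu.resolve_left hpX.1
    unfold step at h4
    rw [hmin, hcand, if_pos] at h4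
    · simp at h4
    · refine ⟨hpd, fun a ha => (hB a ha).trans (by omega), ?_⟩
      simp only [htake]
      rw [hτ]
      exact hk

end

section

variable {lev : ℕ → ℕ} {cert : List ℕ → ℕ → ℕ → Bool}

/-- The set conjectured from the data `σ` using the finite advice `D`. -/
def guess (lev : ℕ → ℕ) (cert : List ℕ → ℕ → ℕ → Bool) (D : List (ℕ × List ℕ)) (σ : List ℕ) :
    Set ℕ :=
  base lev cert ∪
    {x | ∃ t ≥ x, ∃ j < num lev cert t, (ws lev cert t).getD j 0 ∈ σ ∧
      x ∉ (ws lev cert t).take j} ∪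
    {x | ∃ u ∈ D, u.1 ∈ σ ∧ x ∉ u.2}

theorem getD_mem_take {l : List ℕ} {i j : ℕ} (hij : i < j) (hi : i < l.length) :
    l.getD i 0 ∈ l.take j := by
  rw [List.getD_eq_getElem _ _ hi]
  exact List.mem_take_iff_getElem.2 ⟨i, by omega, rfl⟩

theorem getD_not_mem_take {l : List ℕ} (hl : l.Nodup) {i : ℕ} (hi : i < l.length) :
    l.getD i 0 ∉ l.take i := by
  rw [List.getD_eq_getElem _ _ hi]
  intro h
  obtain ⟨k, hk, hke⟩ := List.mem_take_iff_getElem.1 h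
  have := (hl.getElem_inj_iff).1 hke
  omega

theorem getD_eq_of_take_eq {l l' : List ℕ} {i j : ℕ} (hij : i < j) (h : l.take j = l'.take j) :
    l.getD i 0 = l'.getD i 0 := by
  rw [List.getD_eq_getElem?_getD, List.getD_eq_getElem?_getD,
    ← List.getElem?_take_of_lt hij, h, List.getElem?_take_of_lt hij]

theorem guess_eq_base {D : List (ℕ × List ℕ)} {σ : List ℕ}
    (hD : ∀ u ∈ D, u.1 ∉ base lev cert) (hσ : ∀ a ∈ σ, a ∈ base lev cert) :
    guess lev cert D σ = base lev cert := by
  refine Set.Subset.antisymm ?_ fun x hx => Or.inl (Or.inl hx)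
  rintro x ((hx | ⟨t, ht, j, hj, hd, hx⟩) | ⟨u, hu, hd, -⟩)
  · exact hx
  · rcases stable_or_mem_base lev cert (j := j + 1) hj with hs | hs
    · exfalso
      refine not_mem_base_of_take (T := t) (fun t' ht' => (hs t' ht').2) ?_ (hσ _ hd)
      have := num_le_length lev cert t
      exact getD_mem_take (Nat.lt_succ_self j) (by omega)
    · exact hs x ht (by simpa using hx)
  · exact absurd (hσ _ hd) (hD u hu)

theorem exists_advice (hbad : Tendsto lev atTop atTop) :
    ∃ D : List (ℕ × List ℕ), ∀ S : Set ℕ,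
      (S = base lev cert ∨ ∃ j, S = layer lev cert j) →
      ∃ X : List ℕ, (∀ a ∈ X, a ∈ S) ∧ ∀ σ : List ℕ, (∀ a ∈ X, a ∈ σ) → (∀ a ∈ σ, a ∈ S) →
        guess lev cert D σ = S := by
  obtain ⟨D, hD₁, hD₂, hD₃⟩ : ∃ D : List (ℕ × List ℕ),
      (∀ u ∈ D, u.1 ∉ base lev cert) ∧
      (∀ u ∈ D, ∃ n T, (¬ Fixed lev cert (n + 1)) ∧ u.1 ∉ u.2 ∧
        ∀ t ≥ T, (ws lev cert t).take n = u.2) ∧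
      (∀ j, Fixed lev cert j → ¬ Fixed lev cert (j + 1) →
        ∃ u ∈ D, ∃ T, u.1 ∉ u.2 ∧ ∀ t ≥ T, (ws lev cert t).take j = u.2) := by
    by_cases hst : ∀ j, Fixed lev cert j
    · exact ⟨[], by simp, by simp, fun j _ h => absurd (hst _) h⟩
    · push Not at hst
      obtain ⟨j, hj⟩ := hst
      obtain ⟨n, -, hn, hn'⟩ := exists_stuck hj
      obtain ⟨T, l, hl, hT⟩ := hn.take_eq hbad
      obtain ⟨d, hdb, hdl⟩ := exists_not_mem_base (cert := cert) hbad l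
      refine ⟨[(d, l)], by simpa using hdb, ?_, ?_⟩
      · simp only [List.mem_singleton, forall_eq]
        exact ⟨n, T, hn', hdl, fun t ht => (hT t ht).2.2⟩
      · intro i hi hi'
        have : i = n := by
          rcases lt_trichotomy i n with h | h | h
          · exact absurd (hn.mono h) hi'
          · exact h
          · exact absurd (hi.mono h) hn'
        subst this
        exact ⟨(d, l), by simp, T, hdl, fun t ht => (hT t ht).2.2⟩
  refine ⟨D, fun S hS => ?_⟩
  have hbase : S = base lev cert → ∃ X : List ℕ, (∀ a ∈ X, a ∈ S) ∧ ∀ σ : List ℕ,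
      (∀ a ∈ X, a ∈ σ) → (∀ a ∈ σ, a ∈ S) → guess lev cert D σ = S := by
    rintro rfl
    exact ⟨[], by simp, fun σ _ hσ => guess_eq_base hD₁ hσ⟩
  rcases hS with hS | ⟨j, hS⟩
  · exact hbase hS
  rcases layer_eq_base_or lev cert j with hL | ⟨T, l, hT⟩
  · exact hbase (hS.trans hL)
  have hSl : S = {x | x ∉ l} := hS.trans (layer_eq_compl lev cert hT)
  have hbS : base lev cert ⊆ S := hS ▸ base_subset_layer lev cert j
  have hsound : ∀ σ : List ℕ, (∀ a ∈ σ, a ∈ S) → guess lev cert D σ ⊆ S := by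
    intro σ hσ
    rintro x ((hx | ⟨t, ht, i, hi, hd, hx⟩) | ⟨u, hu, hd, hx⟩)
    · exact hbS hx
    · rcases stable_or_mem_base lev cert (j := i + 1) hi with hs | hs
      · have h1 := (hs (max t T) (le_max_left _ _)).2
        have h2 := (hT (max t T) (le_max_right _ _))
        have hlen := num_le_length lev cert (max t T)
        have hni := (hs (max t T) (le_max_left _ _)).1
        have hji : j ≤ i := by
          by_contra hc
          have h3 : (ws lev cert (max t T)).getD i 0 ∈ l := by
            rw [← h2.2]; exact getD_mem_take (by omega) (by omega)
          rw [getD_eq_of_take_eq (Nat.lt_succ_self i) h1] at h3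
          have := hσ _ hd
          rw [hSl] at this
          exact this h3
        rw [hSl]
        intro hxl
        rw [← h2.2] at hxl
        apply hx
        have h4 := congrArg (List.take i) h1
        simp only [List.take_take] at h4
        rw [min_eq_left (Nat.le_succ i)] at h4
        rw [← h4]
        exact List.take_subset_take_left _ hji hxl
      · exact hbS (hs x ht (by simpa using hx))
    · obtain ⟨n, T', hn, -, hT'⟩ := hD₂ u hu
      have hjn : j ≤ n := by
        by_contra hc
        exact hn (Fixed.mono (j := j) ⟨T, fun t ht => (hT t ht).1⟩ (by omega))
      rw [hSl]
      intro hxl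
      apply hx
      rw [← (hT (max T T') (le_max_left _ _)).2] at hxl
      rw [← hT' (max T T') (le_max_right _ _)]
      exact List.take_subset_take_left _ hjn hxl
  by_cases hj : Fixed lev cert (j + 1)
  · obtain ⟨T', l', hl', hT'⟩ := hj.take_eq hbad
    set t₀ := max T T' with ht₀
    have hlen := num_le_length lev cert t₀
    have hn₀ := (hT' t₀ (le_max_right _ _)).2.1
    refine ⟨[(ws lev cert t₀).getD j 0], ?_, ?_⟩
    · simp only [List.mem_singleton, forall_eq]
      rw [hSl, Set.mem_ofPred_eq, ← (hT t₀ (le_max_left _ _)).2]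
      exact getD_not_mem_take (nodup_ws lev cert t₀) (by omega)
    · simp only [List.mem_singleton, forall_eq]
      intro σ hX hσ
      refine Set.Subset.antisymm (hsound σ hσ) fun x hx => ?_
      refine Or.inl (Or.inr ⟨max x t₀, le_max_left _ _, j, ?_, ?_, ?_⟩)
      · exact (hT' _ (le_trans (le_max_right T T') (le_max_right _ _))).2.1
      · rw [getD_eq_of_take_eq (l' := ws lev cert t₀) (Nat.lt_succ_self j)]
        · exact hX
        · rw [(hT' t₀ (le_max_right _ _)).2.2]
          exact (hT' _ (le_trans (le_max_right T T') (le_max_right _ _))).2.2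
      · rw [(hT _ (le_trans (le_max_left T T') (le_max_right _ _))).2]
        rwa [hSl] at hx
  · obtain ⟨u, hu, T', hu1, hT'⟩ := hD₃ j ⟨T, fun t ht => (hT t ht).1⟩ hj
    have hul : u.2 = l := by
      rw [← hT' (max T T') (le_max_right _ _), (hT (max T T') (le_max_left _ _)).2]
    refine ⟨[u.1], ?_, ?_⟩
    · simp only [List.mem_singleton, forall_eq]
      rw [hSl, Set.mem_ofPred_eq, ← hul]
      exact hu1
    · simp only [List.mem_singleton, forall_eq]
      intro σ hX hσ
      refine Set.Subset.antisymm (hsound σ hσ) fun x hx => ?_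
      refine Or.inr ⟨u, hu, hX, ?_⟩
      rw [hul]
      rwa [hSl] at hx

theorem finite_compl_base (h : ¬ Tendsto lev atTop atTop) : (base lev cert)ᶜ.Finite := by
  obtain ⟨m, hm⟩ : ∃ m, ∀ T, ∃ t ≥ T, lev t < m := by
    rw [tendsto_atTop_atTop] at h
    push Not at h
    exact h
  by_contra hc
  obtain ⟨F, hF, hcard⟩ := Set.Infinite.exists_subset_card_eq hc (m + 1)
  obtain ⟨t, ht, hlt⟩ := hm (F.sum id)
  have hsub : F ⊆ (ws lev cert (t + 1)).toFinset := by
    intro x hx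
    rw [List.mem_toFinset]
    by_contra hxn
    refine hF hx ⟨t + 1, ?_, hxn⟩
    have : x ≤ F.sum id := Finset.single_le_sum (f := id) (fun _ _ => Nat.zero_le _) hx
    omega
  have h1 := Finset.card_le_card hsub
  have h2 := List.toFinset_card_le (ws lev cert (t + 1))
  have h3 := length_ws_succ_le lev cert t
  omega

theorem exists_base_union_eq (h : ¬ Tendsto lev atTop atTop) {S : Set ℕ}
    (hS : base lev cert ⊆ S) : ∃ X : List ℕ, (∀ a ∈ X, a ∈ S) ∧
      ∀ σ : List ℕ, (∀ a ∈ X, a ∈ σ) → (∀ a ∈ σ, a ∈ S) → base lev cert ∪ {a | a ∈ σ} = S := by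
  have hfin : (S \ base lev cert).Finite :=
    (finite_compl_base (cert := cert) h).subset fun x hx => hx.2
  refine ⟨hfin.toFinset.toList, ?_, ?_⟩
  · simp +contextual
  · intro σ hX hσ
    refine Set.Subset.antisymm (Set.union_subset hS fun a ha => hσ a ha) fun x hx => ?_
    by_cases hb : x ∈ base lev cert
    · exact Or.inl hb
    · exact Or.inr (hX x (by simp [hx, hb]))

end

end Marker

section CE

open Classical in
theorem exists_index_of_primrecPred {Q : ℕ → ℕ → ℕ → Prop}
    (hQ : PrimrecPred fun p : ℕ × ℕ × ℕ => Q p.1 p.2.1 p.2.2) :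
    ∃ g : ℕ → ℕ, Computable g ∧ ∀ a, Wset (g a) = {y | ∃ t, Q a y t} := by
  have hd : Primrec₂ fun (n : ℕ) (t : ℕ) => decide (Q (Nat.unpair n).1 (Nat.unpair n).2 t) := by
    have hu : Primrec fun p : ℕ × ℕ => Nat.unpair p.1 := Primrec.unpair.comp Primrec.fst
    exact hQ.decide.comp (Primrec.pair (Primrec.fst.comp hu)
      (Primrec.pair (Primrec.snd.comp hu) Primrec.snd))
  have hp : Partrec fun n : ℕ => Nat.rfind fun t =>
      Part.some (decide (Q (Nat.unpair n).1 (Nat.unpair n).2 t)) :=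
    Partrec.rfind hd.to_comp.partrec₂
  obtain ⟨c, hc⟩ := Nat.Partrec.Code.exists_code.1 (Partrec.nat_iff.1 hp)
  refine ⟨fun a => Encodable.encode (Nat.Partrec.Code.curry c a), ?_, ?_⟩
  · exact (Primrec.encode.comp (Nat.Partrec.Code.primrec₂_curry.comp (Primrec.const c)
      Primrec.id)).to_comp
  · intro a
    ext y
    simp only [Wset, Denumerable.ofNat_encode, Nat.Partrec.Code.eval_curry, hc]
    refine Nat.rfind_dom.trans ?_
    simp

end CE

section PrimrecTools

variable {α β : Type*} [Primcodable α] [Primcodable β]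

theorem PrimrecPred.mem_list {f : α → β} {g : α → List β} (hf : Primrec f) (hg : Primrec g) :
    PrimrecPred fun a => f a ∈ g a := by
  classical
  refine (PrimrecPred.exists_mem_list_of hg (Q := fun a x => x = f a)
    (Primrec.eq.comp Primrec.snd (hf.comp Primrec.fst))).of_eq fun a => ?_
  simp

end PrimrecTools

namespace Marker

theorem primrec_avoid : Primrec₂ avoid := by
  have h : PrimrecRel fun (a : ℕ) (v : List ℕ) => a ∉ v :=
    PrimrecPred.not (PrimrecPred.mem_list Primrec.fst Primrec.snd)
  exact h.listFilter.comp Primrec.snd Primrec.fst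

theorem primrec_cand : Primrec cand :=
  (Primrec.ofNat (ℕ × List ℕ × ℕ)).comp (Primrec.fst.comp Primrec.unpair)

theorem primrec_seqCode : Primrec seqCode := Primrec.ofNat (List ℕ)

section

variable {α : Type*} [Primcodable α] {lev : α → ℕ → ℕ} {cert : α → List ℕ → ℕ → ℕ → Bool}

theorem primrec_step
    (hcert : Primrec fun p : α × List ℕ × ℕ × ℕ => cert p.1 p.2.1 p.2.2.1 p.2.2.2) :
    Primrec fun p : α × ℕ × ℕ × List ℕ × ℕ => step (cert p.1) p.2.1 p.2.2.1 p.2.2.2 := by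
  have ha : Primrec fun p : α × ℕ × ℕ × List ℕ × ℕ => p.1 := Primrec.fst
  have hb : Primrec fun p : α × ℕ × ℕ × List ℕ × ℕ => p.2.1 := Primrec.fst.comp Primrec.snd
  have ht : Primrec fun p : α × ℕ × ℕ × List ℕ × ℕ => p.2.2.1 :=
    Primrec.fst.comp (Primrec.snd.comp Primrec.snd)
  have hs : Primrec fun p : α × ℕ × ℕ × List ℕ × ℕ => p.2.2.2 :=
    Primrec.snd.comp (Primrec.snd.comp Primrec.snd)
  have hn : Primrec fun p : α × ℕ × ℕ × List ℕ × ℕ => min p.2.2.2.2 p.2.1 :=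
    Primrec.nat_min.comp (Primrec.snd.comp hs) hb
  have hu : Primrec fun p : α × ℕ × ℕ × List ℕ × ℕ =>
      (p.2.2.2.1 ++ [p.2.2.1 + 1]).take p.2.1 :=
    Primrec.list_take.comp hb (Primrec.list_append.comp (Primrec.fst.comp hs)
      (Primrec.list_cons.comp (Primrec.succ.comp ht) (Primrec.const [])))
  have hc : Primrec fun p : α × ℕ × ℕ × List ℕ × ℕ => cand p.2.2.1 := primrec_cand.comp ht
  have hp : Primrec fun p : α × ℕ × ℕ × List ℕ × ℕ => (cand p.2.2.1).1 := Primrec.fst.comp hc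
  have hv : Primrec fun p : α × ℕ × ℕ × List ℕ × ℕ =>
      ((p.2.2.2.1 ++ [p.2.2.1 + 1]).take p.2.1).take (min p.2.2.2.2 p.2.1) ++
        [(cand p.2.2.1).1] :=
    Primrec.list_append.comp (Primrec.list_take.comp hn hu)
      (Primrec.list_cons.comp hp (Primrec.const []))
  have hτ : Primrec fun p : α × ℕ × ℕ × List ℕ × ℕ =>
      seqCode (min p.2.2.2.2 p.2.1) ++ (cand p.2.2.1).2.1 :=
    Primrec.list_append.comp (primrec_seqCode.comp hn) (Primrec.fst.comp (Primrec.snd.comp hc))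
  refine Primrec.ite (PrimrecPred.and ?_ (PrimrecPred.and ?_ ?_))
    (Primrec.pair hv (Primrec.succ.comp hn)) (Primrec.pair hu hn)
  · exact PrimrecPred.mem_list hp (Primrec.list_drop.comp hn hu)
  · exact PrimrecPred.forall_mem_list_of hτ (Q := fun p x => x ≤ p.2.2.1 + 1)
      (Primrec.nat_le.comp Primrec.snd (Primrec.succ.comp (ht.comp Primrec.fst)))
  · exact PrimrecPred.bool_eq_true (hcert.comp (Primrec.pair ha (Primrec.pair
      (primrec_avoid.comp hv hτ) (Primrec.pair hp (Primrec.snd.comp (Primrec.snd.comp hc))))))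

theorem primrec_state (hlev : Primrec fun p : α × ℕ => lev p.1 p.2)
    (hcert : Primrec fun p : α × List ℕ × ℕ × ℕ => cert p.1 p.2.1 p.2.2.1 p.2.2.2) :
    Primrec fun p : α × ℕ => state (lev p.1) (cert p.1) p.2 := by
  have hstep : Primrec₂ fun (p : α × ℕ) (s : ℕ × List ℕ × ℕ) =>
      step (cert p.1) (lev p.1 s.1) s.1 s.2 := by
    have ha : Primrec fun x : (α × ℕ) × ℕ × List ℕ × ℕ => x.1.1 := Primrec.fst.comp Primrec.fst
    have ht : Primrec fun x : (α × ℕ) × ℕ × List ℕ × ℕ => x.2.1 := Primrec.fst.comp Primrec.snd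
    exact (primrec_step hcert).comp
      (f := fun p : α × ℕ × ℕ × List ℕ × ℕ => step (cert p.1) p.2.1 p.2.2.1 p.2.2.2)
      (g := fun x : (α × ℕ) × ℕ × List ℕ × ℕ => (x.1.1, lev x.1.1 x.2.1, x.2.1, x.2.2))
      (Primrec.pair ha (Primrec.pair
      (hlev.comp (Primrec.pair ha ht)) (Primrec.pair ht (Primrec.snd.comp Primrec.snd))))
  refine (Primrec.nat_rec' Primrec.snd (Primrec.const ([], 0)) hstep).of_eq fun p => ?_
  obtain ⟨a, t⟩ := p
  induction t with
  | zero => rfl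
  | succ t ih => simp only at ih ⊢; rw [state, ← ih]

end

end Marker

section Learning

theorem exists_text_of_chain (A : ℕ → List ℕ) (hpre : ∀ n, A n <+: A (n + 1))
    (hlen : ∀ n, n ≤ (A n).length) :
    ∃ f : ℕ → ℕ, (∀ n, initSeg f (A n).length = A n) ∧ ∀ k, ∃ n, f k ∈ A n := by
  have hmono : ∀ m n, m ≤ n → A m <+: A n := by
    intro m n h
    induction n, h using Nat.le_induction with
    | base => exact List.prefix_rfl
    | succ n _ ih => exact ih.trans (hpre n)
  refine ⟨fun k => (A (k + 1)).getD k 0, fun n => ?_, fun k => ⟨k + 1, ?_⟩⟩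
  · refine List.ext_getElem (by simp [initSeg]) fun k h1 h2 => ?_
    have hk := hlen (k + 1)
    simp only [initSeg, List.getElem_map, List.getElem_range]
    rw [List.getD_eq_getElem _ _ (by omega)]
    rcases le_total (k + 1) n with h | h
    · exact (hmono _ _ h).getElem _
    · exact ((hmono _ _ h).getElem _).symm
  · have hk := hlen (k + 1)
    change (A (k + 1)).getD k 0 ∈ A (k + 1)
    rw [List.getD_eq_getElem _ _ (by omega)]
    exact List.getElem_mem _

theorem TxtBCLearnsSet.exists_locking {M : List ℕ →. ℕ} {S : Set ℕ} (hne : S.Nonempty)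
    (hM : TxtBCLearnsSet M S) (σ : List ℕ) (hσ : ∀ a ∈ σ, a ∈ S) :
    ∃ ρ : List ℕ, (∀ a ∈ ρ, a ∈ S) ∧ ∀ τ : List ℕ, (∀ a ∈ τ, a ∈ S) →
      ∃ h, M (σ ++ ρ ++ τ) = Part.some h ∧ Wset h = S := by
  by_contra hc
  push Not at hc
  choose! ext hext using hc
  obtain ⟨e, he⟩ := (Set.to_countable S).exists_eq_range hne
  have heS : ∀ n, e n ∈ S := fun n => he ▸ Set.mem_range_self n
  let L : ℕ → List ℕ := fun n => Nat.rec [] (fun n l => l ++ [e n] ++ ext (l ++ [e n])) n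
  have hL : ∀ n, L (n + 1) = L n ++ [e n] ++ ext (L n ++ [e n]) := fun n => rfl
  have hLS : ∀ n, (∀ a ∈ L n, a ∈ S) ∧ ∀ a ∈ L n ++ [e n], a ∈ S := by
    intro n
    have aux : (∀ a ∈ L n, a ∈ S) → ∀ a ∈ L n ++ [e n], a ∈ S := by
      intro h a ha
      rcases List.mem_append.1 ha with ha | ha
      · exact h a ha
      · rw [List.mem_singleton.1 ha]; exact heS n
    induction n with
    | zero => exact ⟨fun a ha => absurd ha (by simp [L]), aux fun a ha => absurd ha (by simp [L])⟩
    | succ n ih =>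
      have h1 : ∀ a ∈ L n ++ [e n], a ∈ S := by
        intro a ha
        refine (ih ?_).2 a ha
        intro h a ha
        rcases List.mem_append.1 ha with ha | ha
        · exact h a ha
        · rw [List.mem_singleton.1 ha]; exact heS n
      have h2 : ∀ a ∈ L (n + 1), a ∈ S := by
        intro a ha
        rw [hL] at ha
        rcases List.mem_append.1 ha with ha | ha
        · exact h1 a ha
        · exact (hext _ h1).1 a ha
      exact ⟨h2, aux h2⟩
  have hlen : ∀ n, n ≤ (σ ++ L n).length := by
    intro n
    induction n with
    | zero => exact Nat.zero_le _
    | succ n ih => rw [hL]; simp at ih ⊢; omega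
  obtain ⟨f, hf, hfA⟩ := exists_text_of_chain (fun n => σ ++ L n)
    (fun n => ⟨[e n] ++ ext (L n ++ [e n]), by simp [hL]⟩) hlen
  have hrange : Set.range f = S := by
    refine Set.Subset.antisymm ?_ fun x hx => ?_
    · rintro _ ⟨k, rfl⟩
      obtain ⟨n, hn⟩ := hfA k
      rcases List.mem_append.1 hn with h | h
      · exact hσ _ h
      · exact (hLS n).1 _ h
    · rw [he] at hx
      obtain ⟨n, rfl⟩ := hx
      have h1 : e n ∈ σ ++ L (n + 1) := by simp [hL]
      rw [← hf (n + 1)] at h1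
      obtain ⟨k, -, hk⟩ := List.mem_map.1 h1
      exact ⟨k, hk⟩
  obtain ⟨N, hN⟩ := hM f hrange
  obtain ⟨h, h1, h2⟩ := hN _ ((Nat.le_succ N).trans (hlen (N + 1)))
  refine (hext _ (hLS N).2).2 h ?_ (h2.trans hrange)
  refine (congrArg (fun l => M l) ?_).trans h1
  refine Eq.trans ?_ (hf (N + 1)).symm
  simp [hL]

theorem txtBCLearnsSet_of_finite {M : List ℕ →. ℕ} {S : Set ℕ} (X : List ℕ)
    (hX : ∀ a ∈ X, a ∈ S)
    (h : ∀ σ : List ℕ, σ ≠ [] → (∀ a ∈ X, a ∈ σ) → (∀ a ∈ σ, a ∈ S) →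
      ∃ i, M σ = Part.some i ∧ Wset i = S) : TxtBCLearnsSet M S := by
  rintro f rfl
  choose! k hk using hX
  refine ⟨(X.map k).sum + 1, fun i hi => h _ ?_ ?_ ?_⟩
  · intro h0
    have := congrArg List.length h0
    simp [initSeg] at this
    omega
  · intro a ha
    have := List.le_sum_of_mem (List.mem_map_of_mem (f := k) ha)
    exact List.mem_map.2 ⟨k a, List.mem_range.2 (by omega), hk a ha⟩
  · intro a ha
    obtain ⟨n, -, hn⟩ := List.mem_map.1 ha
    exact ⟨n, hn⟩

theorem exists_eq_learnerOfCode {M : List ℕ →. ℕ} (hM : Partrec M) :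
    ∃ m, learnerOfCode m = M := by
  obtain ⟨c, hc⟩ := Nat.Partrec.Code.exists_code.1 hM
  refine ⟨Encodable.encode c, ?_⟩
  funext σ
  simp only [learnerOfCode, Denumerable.ofNat_encode]
  rw [hc]
  simp only [Encodable.encodek, Part.coe_some, Part.bind_some]
  exact Part.map_id' (fun _ => rfl) _

end Learning

namespace Marker

open Classical in
/-- `certify m q τ p k` holds if within `k` steps the `m`-th learner conjectures, on the data `τ`
tagged by `q`, a set that is seen to contain the tagged `p`. -/
noncomputable def certify (m q : ℕ) (τ : List ℕ) (p k : ℕ) : Bool :=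
  decide (∃ h ∈ Nat.Partrec.Code.evaln k (Denumerable.ofNat Nat.Partrec.Code m)
      (Encodable.encode (τ.map (Nat.pair q))),
    (Nat.Partrec.Code.evaln k (Denumerable.ofNat Nat.Partrec.Code h) (Nat.pair q p)).isSome = true)

theorem certify_iff {m q : ℕ} {τ : List ℕ} {h : ℕ}
    (hm : learnerOfCode m (τ.map (Nat.pair q)) = Part.some h) (p : ℕ) :
    (∃ k, certify m q τ p k = true) ↔ Nat.pair q p ∈ Wset h := by
  simp only [certify, decide_eq_true_eq]
  constructor
  · rintro ⟨k, h', hh', hk⟩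
    have h1 := Nat.Partrec.Code.evaln_sound hh'
    change h' ∈ learnerOfCode m (τ.map (Nat.pair q)) at h1
    rw [hm, Part.mem_some_iff] at h1
    subst h1
    obtain ⟨y, hy⟩ := Option.isSome_iff_exists.1 hk
    exact (Part.dom_iff_mem.2 ⟨y, Nat.Partrec.Code.evaln_sound hy⟩ :)
  · intro hp
    obtain ⟨y, hy⟩ := Part.dom_iff_mem.1 hp
    obtain ⟨k₁, hk₁⟩ := Nat.Partrec.Code.evaln_complete.1 hy
    have h1 : h ∈ learnerOfCode m (τ.map (Nat.pair q)) := by rw [hm]; exact Part.mem_some _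
    obtain ⟨k₂, hk₂⟩ := Nat.Partrec.Code.evaln_complete.1 h1
    refine ⟨max k₁ k₂, h, Nat.Partrec.Code.evaln_mono (le_max_right _ _) hk₂, ?_⟩
    exact Option.isSome_iff_exists.2 ⟨y, Nat.Partrec.Code.evaln_mono (le_max_left _ _) hk₁⟩

theorem primrec_certify :
    Primrec fun p : (ℕ × ℕ) × List ℕ × ℕ × ℕ => certify p.1.1 p.1.2 p.2.1 p.2.2.1 p.2.2.2 := by
  have hq : Primrec fun p : (ℕ × ℕ) × List ℕ × ℕ × ℕ => p.1.2 := Primrec.snd.comp Primrec.fst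
  have hp : Primrec fun p : (ℕ × ℕ) × List ℕ × ℕ × ℕ => p.2.2.1 :=
    Primrec.fst.comp (Primrec.snd.comp Primrec.snd)
  have hk : Primrec fun p : (ℕ × ℕ) × List ℕ × ℕ × ℕ => p.2.2.2 :=
    Primrec.snd.comp (Primrec.snd.comp Primrec.snd)
  refine PrimrecPred.decide (PrimrecPred.exists_mem_option (β := ℕ) ?_
    (Q := fun (p : (ℕ × ℕ) × List ℕ × ℕ × ℕ) h =>
    (Nat.Partrec.Code.evaln p.2.2.2 (Denumerable.ofNat Nat.Partrec.Code h)
      (Nat.pair p.1.2 p.2.2.1)).isSome = true) ?_)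
  · refine Nat.Partrec.Code.primrec_evaln.comp (Primrec.pair (Primrec.pair hk
      ((Primrec.ofNat Nat.Partrec.Code).comp (Primrec.fst.comp Primrec.fst)))
      (Primrec.encode.comp (Primrec.list_map (Primrec.fst.comp Primrec.snd)
        (Primrec₂.natPair.comp (hq.comp Primrec.fst) Primrec.snd).to₂)))
  · refine PrimrecPred.bool_eq_true (Primrec.option_isSome.comp
      (Nat.Partrec.Code.primrec_evaln.comp (Primrec.pair (Primrec.pair (hk.comp Primrec.fst)
        ((Primrec.ofNat Nat.Partrec.Code).comp Primrec.snd))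
        (Primrec₂.natPair.comp (hq.comp Primrec.fst) (hp.comp Primrec.fst)))))

/-- The members of the family. -/
def member (lev : ℕ → ℕ) (cert : List ℕ → ℕ → ℕ → Bool) : ℕ → Set ℕ
  | 0 => base lev cert
  | j + 1 => layer lev cert j

theorem member_eq (lev : ℕ → ℕ) (cert : List ℕ → ℕ → ℕ → Bool) (j : ℕ) :
    member lev cert j = base lev cert ∨ ∃ i, member lev cert j = layer lev cert i := by
  cases j with
  | zero => exact Or.inl rfl
  | succ j => exact Or.inr ⟨j, rfl⟩

theorem base_subset_member (lev : ℕ → ℕ) (cert : List ℕ → ℕ → ℕ → Bool) (j : ℕ) :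
    base lev cert ⊆ member lev cert j := by
  cases j with
  | zero => exact subset_rfl
  | succ j => exact base_subset_layer lev cert j

theorem mem_member_iff (lev : ℕ → ℕ) (cert : List ℕ → ℕ → ℕ → Bool) (j x : ℕ) :
    x ∈ member lev cert j ↔ ∃ t, x ≤ t ∧ (x ∉ ws lev cert t ∨
      (j ≠ 0 ∧ j - 1 ≤ num lev cert t ∧ x ∉ (ws lev cert t).take (j - 1))) := by
  cases j with
  | zero => simp [member, base]
  | succ j =>
    simp only [member, layer, base, Set.mem_union]
    constructor
    · rintro (⟨t, h1, h2⟩ | ⟨t, h1, h2⟩)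
      · exact ⟨t, h1, Or.inl h2⟩
      · exact ⟨t, h1, Or.inr ⟨by omega, h2⟩⟩
    · rintro ⟨t, h1, h2 | h2⟩
      · exact Or.inl ⟨t, h1, h2⟩
      · exact Or.inr ⟨t, h1, h2.2⟩

/-- A learner that succeeds on all tagged members of the family prevents the level function from
tending to infinity. -/
theorem not_tendsto_of_learns {lev : ℕ → ℕ} {m q : ℕ}
    (hM : ∀ j, TxtBCLearnsSet (learnerOfCode m)
      (Nat.pair q '' member lev (certify m q) j)) : ¬ Tendsto lev atTop atTop := by
  intro hbad
  refine not_locking (cert := certify m q) hbad fun S hS σ₀ hσ₀ => ?_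
  obtain ⟨j, rfl⟩ : ∃ j, S = member lev (certify m q) j := by
    rcases hS with rfl | ⟨j, rfl⟩
    · exact ⟨0, rfl⟩
    · exact ⟨j + 1, rfl⟩
  have hne : (Nat.pair q '' member lev (certify m q) j).Nonempty :=
    ⟨_, 0, base_subset_member _ _ _ (zero_mem_base _ _), rfl⟩
  obtain ⟨ρ', hρ', hlock⟩ := (hM j).exists_locking hne (σ₀.map (Nat.pair q)) (by
    intro a ha
    obtain ⟨b, hb, rfl⟩ := List.mem_map.1 ha
    exact ⟨b, hσ₀ b hb, rfl⟩)
  have hmap : (ρ'.map fun y => (Nat.unpair y).2).map (Nat.pair q) = ρ' := by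
    rw [List.map_map]
    refine (List.map_congr_left fun b hb => ?_).trans (List.map_id _)
    obtain ⟨c, _, rfl⟩ := hρ' b hb
    simp
  refine ⟨ρ'.map fun y => (Nat.unpair y).2, ?_, fun τ hτ p => ?_⟩
  · intro a ha
    obtain ⟨b, hb, rfl⟩ := List.mem_map.1 ha
    obtain ⟨c, hc, rfl⟩ := hρ' b hb
    simpa using hc
  · obtain ⟨h, h1, h2⟩ := hlock (τ.map (Nat.pair q)) (by
      intro a ha
      obtain ⟨b, hb, rfl⟩ := List.mem_map.1 ha
      exact ⟨b, hτ b hb, rfl⟩)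
    rw [certify_iff (h := h), h2]
    · simp
    · rw [List.map_append, List.map_append, hmap]
      exact h1

theorem exists_family_index {lev : ℕ → ℕ → ℕ → ℕ} {cert : ℕ → List ℕ → ℕ → ℕ → Bool}
    (hlev : Primrec fun p : (ℕ × ℕ) × ℕ => lev p.1.1 p.1.2 p.2)
    (hcert : Primrec fun p : ℕ × List ℕ × ℕ × ℕ => cert p.1 p.2.1 p.2.2.1 p.2.2.2) :
    ∃ g : ℕ → ℕ, Computable g ∧ ∀ e q j,
      column (g e) (Nat.pair q j) = Nat.pair q '' member (lev e q) (cert q) j := by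
  have hst : Primrec fun p : (ℕ × ℕ) × ℕ => state (lev p.1.1 p.1.2) (cert p.1.2) p.2 :=
    primrec_state (lev := fun a : ℕ × ℕ => lev a.1 a.2) (cert := fun a : ℕ × ℕ => cert a.2) hlev
      (hcert.comp (Primrec.pair (Primrec.snd.comp Primrec.fst) Primrec.snd))
  let ix : ℕ → ℕ × ℕ := fun y => Nat.unpair (Nat.unpair y).1
  let pt : ℕ → ℕ × ℕ := fun y => Nat.unpair (Nat.unpair y).2
  have hix : Primrec fun p : ℕ × ℕ × ℕ => ix p.2.1 :=
    Primrec.unpair.comp (Primrec.fst.comp (Primrec.unpair.comp (Primrec.fst.comp Primrec.snd)))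
  have hpt : Primrec fun p : ℕ × ℕ × ℕ => pt p.2.1 :=
    Primrec.unpair.comp (Primrec.snd.comp (Primrec.unpair.comp (Primrec.fst.comp Primrec.snd)))
  have ht : Primrec fun p : ℕ × ℕ × ℕ => p.2.2 := Primrec.snd.comp Primrec.snd
  have hs : Primrec fun p : ℕ × ℕ × ℕ =>
      state (lev p.1 (ix p.2.1).1) (cert (ix p.2.1).1) p.2.2 :=
    hst.comp (f := fun p : (ℕ × ℕ) × ℕ => state (lev p.1.1 p.1.2) (cert p.1.2) p.2)
      (g := fun p : ℕ × ℕ × ℕ => ((p.1, (ix p.2.1).1), p.2.2))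
      (Primrec.pair (Primrec.pair Primrec.fst (Primrec.fst.comp hix)) ht)
  have hj : Primrec fun p : ℕ × ℕ × ℕ => (ix p.2.1).2 := Primrec.snd.comp hix
  have hx : Primrec fun p : ℕ × ℕ × ℕ => (pt p.2.1).2 := Primrec.snd.comp hpt
  have hj1 : Primrec fun p : ℕ × ℕ × ℕ => (ix p.2.1).2 - 1 :=
    Primrec.nat_sub.comp hj (Primrec.const 1)
  obtain ⟨g, hg, hW⟩ := exists_index_of_primrecPred (Q := fun e y t =>
    (pt y).1 = (ix y).1 ∧ (pt y).2 ≤ t ∧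
      ((pt y).2 ∉ (state (lev e (ix y).1) (cert (ix y).1) t).1 ∨
        ((ix y).2 ≠ 0 ∧ (ix y).2 - 1 ≤ (state (lev e (ix y).1) (cert (ix y).1) t).2 ∧
          (pt y).2 ∉ (state (lev e (ix y).1) (cert (ix y).1) t).1.take ((ix y).2 - 1)))) <|
    PrimrecPred.and (Primrec.eq.comp (Primrec.fst.comp hpt) (Primrec.fst.comp hix)) <|
    PrimrecPred.and (Primrec.nat_le.comp hx ht) <|
    PrimrecPred.or (PrimrecPred.not (PrimrecPred.mem_list hx (Primrec.fst.comp hs))) <|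
    PrimrecPred.and (PrimrecPred.not (Primrec.eq.comp hj (Primrec.const 0))) <|
    PrimrecPred.and (Primrec.nat_le.comp hj1 (Primrec.snd.comp hs)) <|
    PrimrecPred.not (PrimrecPred.mem_list hx (Primrec.list_take.comp hj1 (Primrec.fst.comp hs)))
  refine ⟨g, hg, fun e q j => ?_⟩
  ext z
  change Nat.pair (Nat.pair q j) z ∈ Wset (g e) ↔ _
  rw [hW]
  simp only [Set.mem_ofPred_eq, Set.mem_image, mem_member_iff, ix, pt, Nat.unpair_pair]
  constructor
  · rintro ⟨t, h1, h2, h3⟩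
    exact ⟨_, ⟨t, h2, h3⟩, by rw [← h1, Nat.pair_unpair]⟩
  · rintro ⟨x, ⟨t, h2, h3⟩, rfl⟩
    exact ⟨t, by simp, by simpa using h2, by simpa [ws, num] using h3⟩

theorem exists_learner {lev : ℕ → ℕ → ℕ} {cert : ℕ → List ℕ → ℕ → ℕ → Bool}
    (hlev : Primrec fun p : ℕ × ℕ => lev p.1 p.2)
    (hcert : Primrec fun p : ℕ × List ℕ × ℕ × ℕ => cert p.1 p.2.1 p.2.2.1 p.2.2.2)
    (bad : List ℕ) (tbl : List (ℕ × ℕ × List ℕ)) :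
    ∃ gl : List ℕ → ℕ, Computable gl ∧ ∀ q a σ, (Nat.unpair ((σ : List ℕ).headI)).1 = q →
      σ = (a : List ℕ).map (Nat.pair q) →
      Wset (gl σ) = Nat.pair q '' if q ∈ bad then
        guess (lev q) (cert q) ((tbl.filter fun u => u.1 = q).map Prod.snd) a
      else base (lev q) (cert q) ∪ {x | x ∈ a} := by
  classical
  have hst : Primrec fun p : ℕ × ℕ => state (lev p.1) (cert p.1) p.2 :=
    primrec_state hlev hcert
  have hσ : Primrec fun p : ℕ × ℕ × ℕ => seqCode p.1 := primrec_seqCode.comp Primrec.fst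
  have hyu : Primrec fun p : ℕ × ℕ × ℕ => Nat.unpair p.2.1 :=
    Primrec.unpair.comp (Primrec.fst.comp Primrec.snd)
  have hsu : Primrec fun p : ℕ × ℕ × ℕ => Nat.unpair p.2.2 :=
    Primrec.unpair.comp (Primrec.snd.comp Primrec.snd)
  have hq : Primrec fun p : ℕ × ℕ × ℕ => (Nat.unpair p.2.1).1 := Primrec.fst.comp hyu
  have hx : Primrec fun p : ℕ × ℕ × ℕ => (Nat.unpair p.2.1).2 := Primrec.snd.comp hyu
  have ht : Primrec fun p : ℕ × ℕ × ℕ => (Nat.unpair p.2.2).1 := Primrec.fst.comp hsu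
  have hj : Primrec fun p : ℕ × ℕ × ℕ => (Nat.unpair p.2.2).2 := Primrec.snd.comp hsu
  have hs : Primrec fun p : ℕ × ℕ × ℕ =>
      state (lev (Nat.unpair p.2.1).1) (cert (Nat.unpair p.2.1).1) (Nat.unpair p.2.2).1 :=
    hst.comp (f := fun p : ℕ × ℕ => state (lev p.1) (cert p.1) p.2)
      (g := fun p : ℕ × ℕ × ℕ => ((Nat.unpair p.2.1).1, (Nat.unpair p.2.2).1))
      (Primrec.pair hq ht)
  have hw : Primrec fun p : ℕ × ℕ × ℕ => (state (lev (Nat.unpair p.2.1).1)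
      (cert (Nat.unpair p.2.1).1) (Nat.unpair p.2.2).1).1 := Primrec.fst.comp hs
  have hn : Primrec fun p : ℕ × ℕ × ℕ => (state (lev (Nat.unpair p.2.1).1)
      (cert (Nat.unpair p.2.1).1) (Nat.unpair p.2.2).1).2 := Primrec.snd.comp hs
  have hb : PrimrecPred fun p : ℕ × ℕ × ℕ => (Nat.unpair p.2.1).1 ∈ bad :=
    PrimrecPred.mem_list hq (Primrec.const bad)
  obtain ⟨g, hg, hW⟩ := exists_index_of_primrecPred (Q := fun c y s =>
    (Nat.unpair y).1 = (Nat.unpair (seqCode c).headI).1 ∧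
      (((Nat.unpair y).2 ≤ (Nat.unpair s).1 ∧ (Nat.unpair y).2 ∉
          (state (lev (Nat.unpair y).1) (cert (Nat.unpair y).1) (Nat.unpair s).1).1) ∨
        ((Nat.unpair y).1 ∉ bad ∧ y ∈ seqCode c) ∨
        ((Nat.unpair y).1 ∈ bad ∧ (Nat.unpair y).2 ≤ (Nat.unpair s).1 ∧ (Nat.unpair s).2 <
          (state (lev (Nat.unpair y).1) (cert (Nat.unpair y).1) (Nat.unpair s).1).2 ∧
          Nat.pair (Nat.unpair y).1 ((state (lev (Nat.unpair y).1) (cert (Nat.unpair y).1)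
            (Nat.unpair s).1).1.getD (Nat.unpair s).2 0) ∈ seqCode c ∧
          (Nat.unpair y).2 ∉ (state (lev (Nat.unpair y).1) (cert (Nat.unpair y).1)
            (Nat.unpair s).1).1.take (Nat.unpair s).2) ∨
        ((Nat.unpair y).1 ∈ bad ∧ ∃ u ∈ tbl, u.1 = (Nat.unpair y).1 ∧
          Nat.pair (Nat.unpair y).1 u.2.1 ∈ seqCode c ∧ (Nat.unpair y).2 ∉ u.2.2))) <|
    PrimrecPred.and (Primrec.eq.comp hq
      (Primrec.fst.comp (Primrec.unpair.comp (Primrec.list_headI.comp hσ)))) <|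
    PrimrecPred.or (PrimrecPred.and (Primrec.nat_le.comp hx ht)
      (PrimrecPred.not (PrimrecPred.mem_list hx hw))) <|
    PrimrecPred.or (PrimrecPred.and (PrimrecPred.not hb)
      (PrimrecPred.mem_list (Primrec.fst.comp Primrec.snd) hσ)) <|
    PrimrecPred.or (PrimrecPred.and hb <|
      PrimrecPred.and (Primrec.nat_le.comp hx ht) <|
      PrimrecPred.and (Primrec.nat_lt.comp hj hn) <|
      PrimrecPred.and (PrimrecPred.mem_list (Primrec₂.natPair.comp hq
        ((Primrec.list_getD 0).comp hw hj)) hσ)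
      (PrimrecPred.not (PrimrecPred.mem_list hx (Primrec.list_take.comp hj hw)))) <|
    PrimrecPred.and hb <| PrimrecPred.exists_mem_list_of (Primrec.const tbl)
      (Q := fun (p : ℕ × ℕ × ℕ) (u : ℕ × ℕ × List ℕ) => u.1 = (Nat.unpair p.2.1).1 ∧
          Nat.pair (Nat.unpair p.2.1).1 u.2.1 ∈ seqCode p.1 ∧ (Nat.unpair p.2.1).2 ∉ u.2.2) <|
      PrimrecPred.and (Primrec.eq.comp (Primrec.fst.comp Primrec.snd) (hq.comp Primrec.fst)) <|
      PrimrecPred.and (PrimrecPred.mem_list (Primrec₂.natPair.comp (hq.comp Primrec.fst)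
        (Primrec.fst.comp (Primrec.snd.comp Primrec.snd))) (hσ.comp Primrec.fst)) <|
      PrimrecPred.not (PrimrecPred.mem_list (hx.comp Primrec.fst)
        (Primrec.snd.comp (Primrec.snd.comp Primrec.snd)))
  refine ⟨fun σ => g (Encodable.encode σ), hg.comp Primrec.encode.to_comp,
    fun q a σ hσq hσa => ?_⟩
  have hmem : ∀ x, Nat.pair q x ∈ σ ↔ x ∈ a := by
    intro x
    rw [hσa, List.mem_map]
    constructor
    · rintro ⟨b, hb, h⟩
      rwa [← (Nat.pair_eq_pair.1 h).2]
    · exact fun h => ⟨x, h, rfl⟩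
  have hsc : seqCode (Encodable.encode σ) = σ := Denumerable.ofNat_encode σ
  ext y
  rw [hW, Set.mem_ofPred_eq, hsc, hσq]
  obtain ⟨q', x, rfl⟩ : ∃ q' x, y = Nat.pair q' x := ⟨_, _, (Nat.pair_unpair y).symm⟩
  simp only [Nat.unpair_pair]
  by_cases hqq : q' = q
  swap
  · simp only [hqq, false_and, exists_false, false_iff]
    rintro ⟨z, -, hz⟩
    exact hqq (Nat.pair_eq_pair.1 hz).1.symm
  subst hqq
  have himg : ∀ S : Set ℕ, Nat.pair q' x ∈ Nat.pair q' '' S ↔ x ∈ S := by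
    intro S
    constructor
    · rintro ⟨z, hz, h⟩
      rwa [← (Nat.pair_eq_pair.1 h).2]
    · exact fun h => ⟨x, h, rfl⟩
  rw [himg]
  simp only [hmem, true_and]
  split_ifs with hbad
  · simp only [hbad, not_true_eq_false, false_and, false_or, true_and]
    constructor
    · rintro ⟨s, ⟨h1, h2⟩ | ⟨h1, h2, h3, h4⟩ | ⟨u, hu, h1, h2, h3⟩⟩
      · exact Or.inl (Or.inl ⟨_, h1, h2⟩)
      · exact Or.inl (Or.inr ⟨_, h1, _, h2, h3, h4⟩)
      · exact Or.inr ⟨u.2, List.mem_map.2 ⟨u, by simp [hu, h1], rfl⟩, h2, h3⟩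
    · rintro ((⟨t, h1, h2⟩ | ⟨t, h1, j, h2, h3, h4⟩) | ⟨u, hu, h2, h3⟩)
      · exact ⟨Nat.pair t 0, Or.inl (by rw [Nat.unpair_pair]; exact ⟨h1, h2⟩)⟩
      · exact ⟨Nat.pair t j, Or.inr (Or.inl (by rw [Nat.unpair_pair]; exact ⟨h1, h2, h3, h4⟩))⟩
      · obtain ⟨v, hv, rfl⟩ := List.mem_map.1 hu
        rw [List.mem_filter, decide_eq_true_eq] at hv
        exact ⟨0, Or.inr (Or.inr ⟨v, hv.1, hv.2, h2, h3⟩)⟩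
  · simp only [hbad, not_false_eq_true, false_and, or_false, true_and]
    constructor
    · rintro ⟨s, ⟨h1, h2⟩ | h⟩
      · exact Or.inl ⟨_, h1, h2⟩
      · exact Or.inr h
    · rintro (⟨t, h1, h2⟩ | h)
      · exact ⟨Nat.pair t 0, Or.inl (by rw [Nat.unpair_pair]; exact ⟨h1, h2⟩)⟩
      · exact ⟨0, Or.inr h⟩

theorem exists_learner_of_finite {lev : ℕ → ℕ → ℕ} {cert : ℕ → List ℕ → ℕ → ℕ → Bool}
    (hlev : Primrec fun p : ℕ × ℕ => lev p.1 p.2)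
    (hcert : Primrec fun p : ℕ × List ℕ × ℕ × ℕ => cert p.1 p.2.1 p.2.2.1 p.2.2.2)
    (hfin : {q | Tendsto (lev q) atTop atTop}.Finite) :
    ∃ M : List ℕ →. ℕ, Partrec M ∧
      ∀ q j, TxtBCLearnsSet M (Nat.pair q '' member (lev q) (cert q) j) := by
  classical
  have hD := fun q (hq : Tendsto (lev q) atTop atTop) => exists_advice (cert := cert q) hq
  choose! D hD using hD
  let bad := hfin.toFinset.toList
  let tbl := bad.flatMap fun q => (D q).map fun u => (q, u)
  have hbad : ∀ q, q ∈ bad ↔ Tendsto (lev q) atTop atTop := by simp [bad]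
  obtain ⟨gl, hgl, hW⟩ := exists_learner hlev hcert bad tbl
  refine ⟨fun σ => Part.some (gl σ), hgl, fun q j => ?_⟩
  obtain ⟨X, hX, hXσ⟩ : ∃ X : List ℕ, (∀ a ∈ X, a ∈ member (lev q) (cert q) j) ∧
      ∀ σ : List ℕ, (∀ a ∈ X, a ∈ σ) → (∀ a ∈ σ, a ∈ member (lev q) (cert q) j) →
        (if q ∈ bad then
          guess (lev q) (cert q) ((tbl.filter fun u => u.1 = q).map Prod.snd) σ
        else base (lev q) (cert q) ∪ {x | x ∈ σ}) = member (lev q) (cert q) j := by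
    split_ifs with h
    · have hmem : ∀ u, u ∈ (tbl.filter fun u => u.1 = q).map Prod.snd ↔ u ∈ D q := by
        intro u
        simp only [tbl, List.mem_map, List.mem_filter, List.mem_flatMap, decide_eq_true_eq]
        constructor
        · rintro ⟨_, ⟨⟨q', _, v, hv, rfl⟩, rfl⟩, rfl⟩
          exact hv
        · exact fun hu => ⟨(q, u), ⟨⟨q, h, u, hu, rfl⟩, rfl⟩, rfl⟩
      simp only [guess, hmem]
      exact hD q ((hbad q).1 h) _ (member_eq _ _ _)
    · exact exists_base_union_eq (fun h' => h ((hbad q).2 h')) (base_subset_member _ _ _)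
  refine txtBCLearnsSet_of_finite (X.map (Nat.pair q)) ?_ fun σ hne hXs hσ => ⟨_, rfl, ?_⟩
  · intro a ha
    obtain ⟨b, hb, rfl⟩ := List.mem_map.1 ha
    exact ⟨b, hX b hb, rfl⟩
  · have hmap : σ = (σ.map fun y => (Nat.unpair y).2).map (Nat.pair q) := by
      rw [List.map_map]
      refine ((List.map_congr_left fun b hb => ?_).trans (List.map_id _)).symm
      obtain ⟨c, _, rfl⟩ := hσ b hb
      simp
    rw [hW q _ σ ?_ hmap, hXσ]
    · intro a ha
      exact List.mem_map.2 ⟨_, hXs _ (List.mem_map_of_mem ha), by simp⟩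
    · intro a ha
      obtain ⟨b, hb, rfl⟩ := List.mem_map.1 ha
      obtain ⟨c, hc, rfl⟩ := hσ b hb
      simpa using hc
    · obtain ⟨a, τ, rfl⟩ := List.exists_cons_of_ne_nil hne
      obtain ⟨c, _, rfl⟩ := hσ a List.mem_cons_self
      simp

end Marker

/-- BCL is Σ⁰₅-hard. -/
theorem BCL_sigma5_hard :
    ∀ P : Set ℕ, IsSigma5 P →
      ∃ g : ℕ → ℕ, Computable g ∧ ∀ e, e ∈ P ↔ g e ∈ BCL := by
  intro P hP
  obtain ⟨lev, idx, hlev, hidx, hfin, hinf⟩ := hP.exists_level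
  have hcert : Primrec fun p : ℕ × List ℕ × ℕ × ℕ =>
      Marker.certify (idx p.1) p.1 p.2.1 p.2.2.1 p.2.2.2 :=
    Marker.primrec_certify.comp (Primrec.pair (Primrec.pair (hidx.comp Primrec.fst) Primrec.fst)
      Primrec.snd)
  obtain ⟨g, hg, hcol⟩ := Marker.exists_family_index
    (cert := fun q => Marker.certify (idx q) q) hlev hcert
  refine ⟨g, hg, fun e => ⟨fun he => ?_, fun ⟨M, hM, hlearn⟩ => ?_⟩⟩
  · have hlev' : Primrec fun p : ℕ × ℕ => lev e p.1 p.2 :=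
      hlev.comp (f := fun p : (ℕ × ℕ) × ℕ => lev p.1.1 p.1.2 p.2)
        (g := fun p : ℕ × ℕ => ((e, p.1), p.2))
        (Primrec.pair (Primrec.pair (Primrec.const e) Primrec.fst) Primrec.snd)
    obtain ⟨M, hM, hlearn⟩ := Marker.exists_learner_of_finite
      (cert := fun q => Marker.certify (idx q) q) hlev' hcert (hfin e he)
    refine ⟨M, hM, fun i => ?_⟩
    rw [← Nat.pair_unpair i, hcol]
    exact hlearn _ _
  · by_contra he
    obtain ⟨m, rfl⟩ := exists_eq_learnerOfCode hM
    obtain ⟨q, rfl, hq⟩ := hinf e he m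
    exact Marker.not_tendsto_of_learns (fun j => hcol e q j ▸ hlearn _) hq
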